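/- Let n ≥ 1, p > 2, and let Ω be the open unit ball of ℝⁿ. For every ε > 0 there exists a constant M = M(n,p,ε) > 0 with the following property: if u₀ ∈ X satisfies ∫_Ω u₀(x)(1 − |x|) dx ≥ M, then for every family (u_j)_{j≥1} where each u_j is a classical solution of the j-th regularized problem with data u₀, and for every x₀ ∈ ∂Ω, there exist y₀ ∈ ∂Ω with |y₀ − x₀| < ε and t > 0 such that liminf_{x→y₀, x∈Ω} sup_{j≥1} u_j(x,t) > 0 (i.e., the loss of boundary conditions set of the global viscosity solution meets the ball B_ε(x₀)). Here the weight 1 − |x| = dist(x, ∂Ω) is comparable to the normalized first Dirichlet eigenfunction φ₁ of −Δ in Ω, so this hypothesis is equivalent, up to the value of M, to ∫_Ω u₀ φ₁ dx ≥ M. -/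

import Mathlib

open Set Filter Metric MeasureTheory Topology
open scoped ENNReal

noncomputable section

/-- Euclidean space ℝⁿ. -/
abbrev Euc (n : ℕ) := EuclideanSpace ℝ (Fin n)

/-- Membership in the class `X` of `C¹(Ω̄)` functions that are nonnegative on `Ω̄`
and vanish on `∂Ω`. -/
def MemX {n : ℕ} (Ω : Set (Euc n)) (v : Euc n → ℝ) : Prop :=
  ContDiffOn ℝ 1 v (closure Ω) ∧ (∀ x ∈ closure Ω, 0 ≤ v x) ∧ ∀ x ∈ frontier Ω, v x = 0

/-- The regularized Hamiltonian `F_j(ξ) = min(|ξ|^p, j^{p-2}|ξ|²)`. -/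
def Fj (n : ℕ) (p : ℝ) (j : ℕ) (ξ : Euc n) : ℝ :=
  min (‖ξ‖ ^ p) ((j : ℝ) ^ (p - 2) * ‖ξ‖ ^ 2)

/-- The Laplacian, as the sum of the second partial derivatives. -/
def lap (n : ℕ) (f : Euc n → ℝ) (x : Euc n) : ℝ :=
  ∑ i : Fin n,
    fderiv ℝ (fun y => fderiv ℝ f y (EuclideanSpace.single i 1)) x (EuclideanSpace.single i 1)

/-- `u` is a classical solution of the `j`-th regularized problem
`∂ₜu = Δu + F_j(∇u)` in `Ω × (0,∞)`, `u = 0` on `∂Ω × (0,∞)`, `u(·,0) = u₀`. -/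
structure IsRegSol (n : ℕ) (p : ℝ) (Ω : Set (Euc n)) (j : ℕ) (u0 : Euc n → ℝ)
    (u : Euc n → ℝ → ℝ) : Prop where
  cont : ContinuousOn (fun q : Euc n × ℝ => u q.1 q.2) (closure Ω ×ˢ Ici (0:ℝ))
  nonneg : ∀ x ∈ closure Ω, ∀ t ∈ Ici (0:ℝ), 0 ≤ u x t
  time_reg : ∀ x ∈ Ω, ContDiffOn ℝ 1 (fun s => u x s) (Ioi (0:ℝ))
  space_reg : ∀ t ∈ Ioi (0:ℝ), ContDiffOn ℝ 2 (fun y => u y t) Ω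
  eqn : ∀ x ∈ Ω, ∀ t ∈ Ioi (0:ℝ),
    deriv (fun s => u x s) t = lap n (fun y => u y t) x + Fj n p j (gradient (fun y => u y t) x)
  bc : ∀ x ∈ frontier Ω, ∀ t ∈ Ioi (0:ℝ), u x t = 0
  ic : ∀ x ∈ closure Ω, u x 0 = u0 x

/-- The pointwise supremum `U(x,t) = sup_{j ≥ 1} u_j(x,t)` of a family of approximating
solutions; on `Ω × (0,∞)` this coincides with the global viscosity solution. -/
def Usup {n : ℕ} (u : ℕ → Euc n → ℝ → ℝ) (x : Euc n) (t : ℝ) : ℝ :=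
  ⨆ j : {j : ℕ // 1 ≤ j}, u j.1 x t

/-- The time interval `[0,T)` (as a subset of ℝ), `T ∈ (0,∞]`. -/
def TimeIcc (T : ℝ≥0∞) : Set ℝ := {t : ℝ | 0 ≤ t ∧ ENNReal.ofReal t < T}

/-- The time interval `(0,T)` (as a subset of ℝ), `T ∈ (0,∞]`. -/
def TimeIoo (T : ℝ≥0∞) : Set ℝ := {t : ℝ | 0 < t ∧ ENNReal.ofReal t < T}

/-- `u` is a classical solution of the Dirichlet problem `∂ₜu = Δu + |∇u|^p` in `Ω × (0,T)`,
`u = 0` on `∂Ω × [0,T)`, `u(·,0) = u₀`, with `u` and `∇u` continuous on `Ω̄ × [0,T)`. -/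
structure IsClassicalSol (n : ℕ) (p : ℝ) (Ω : Set (Euc n)) (u0 : Euc n → ℝ)
    (u : Euc n → ℝ → ℝ) (T : ℝ≥0∞) : Prop where
  cont : ContinuousOn (fun q : Euc n × ℝ => u q.1 q.2) (closure Ω ×ˢ TimeIcc T)
  grad_cont : ∃ G : Euc n × ℝ → Euc n, ContinuousOn G (closure Ω ×ˢ TimeIcc T) ∧
    ∀ x ∈ Ω, ∀ t ∈ TimeIoo T, G (x, t) = gradient (fun y => u y t) x
  time_reg : ∀ x ∈ Ω, ContDiffOn ℝ 1 (fun s => u x s) (TimeIoo T)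
  space_reg : ∀ t ∈ TimeIoo T, ContDiffOn ℝ 2 (fun y => u y t) Ω
  eqn : ∀ x ∈ Ω, ∀ t ∈ TimeIoo T,
    deriv (fun s => u x s) t = lap n (fun y => u y t) x + ‖gradient (fun y => u y t) x‖ ^ p
  bc : ∀ x ∈ frontier Ω, ∀ t ∈ TimeIcc T, u x t = 0
  ic : ∀ x ∈ closure Ω, u x 0 = u0 x

/-- `f` is differentiable near `x` and its derivative is differentiable at `x`. -/
def TwiceDiffAt {n : ℕ} (f : Euc n → ℝ) (x : Euc n) : Prop :=
  (∀ᶠ y in 𝓝 x, DifferentiableAt ℝ f y) ∧ DifferentiableAt ℝ (fderiv ℝ f) x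

theorem TwiceDiffAt.of_contDiffAt {n : ℕ} {f : Euc n → ℝ} {x : Euc n}
    (h : ContDiffAt ℝ 2 f x) : TwiceDiffAt f x := by
  refine ⟨?_, ?_⟩
  · filter_upwards [h.eventually (by simp)] with y hy using hy.differentiableAt (by simp)
  · exact (h.fderiv_right (m := 1) (by norm_num)).differentiableAt (by simp)

theorem TwiceDiffAt.of_hasFDerivAt {n : ℕ} {f : Euc n → ℝ} {x : Euc n}
    {f' : Euc n → Euc n →L[ℝ] ℝ} {f'' : Euc n →L[ℝ] Euc n →L[ℝ] ℝ}
    (h : ∀ᶠ y in 𝓝 x, HasFDerivAt f (f' y) y) (h' : HasFDerivAt f' f'' x) :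
    TwiceDiffAt f x ∧ HasFDerivAt (fderiv ℝ f) f'' x := by
  have : fderiv ℝ f =ᶠ[𝓝 x] f' := h.mono fun y hy => hy.fderiv
  have h2 := h'.congr_of_eventuallyEq this
  exact ⟨⟨h.mono fun y hy => hy.differentiableAt, h2.differentiableAt⟩, h2⟩

theorem lap_eq_sum_of_hasFDerivAt {n : ℕ} {f : Euc n → ℝ} {x : Euc n}
    {f'' : Euc n →L[ℝ] Euc n →L[ℝ] ℝ} (h : HasFDerivAt (fderiv ℝ f) f'' x) :
    lap n f x = ∑ i : Fin n, f'' (EuclideanSpace.single i 1) (EuclideanSpace.single i 1) := by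
  unfold lap
  refine Finset.sum_congr rfl fun i _ => ?_
  have := h.clm_apply (hasFDerivAt_const (EuclideanSpace.single i (1:ℝ)) x)
  rw [this.fderiv]
  simp

theorem TwiceDiffAt.sub {n : ℕ} {f g : Euc n → ℝ} {x : Euc n}
    (hf : TwiceDiffAt f x) (hg : TwiceDiffAt g x) :
    TwiceDiffAt (fun y => f y - g y) x ∧
      lap n (fun y => f y - g y) x = lap n f x - lap n g x := by
  have h1 : ∀ᶠ y in 𝓝 x, HasFDerivAt (fun y => f y - g y) (fderiv ℝ f y - fderiv ℝ g y) y := by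
    filter_upwards [hf.1, hg.1] with y h1 h2 using h1.hasFDerivAt.sub h2.hasFDerivAt
  obtain ⟨h2, h3⟩ := TwiceDiffAt.of_hasFDerivAt h1 (hf.2.hasFDerivAt.sub hg.2.hasFDerivAt)
  refine ⟨h2, ?_⟩
  rw [lap_eq_sum_of_hasFDerivAt h3, lap_eq_sum_of_hasFDerivAt hf.2.hasFDerivAt,
    lap_eq_sum_of_hasFDerivAt hg.2.hasFDerivAt, ← Finset.sum_sub_distrib]
  simp

theorem deriv_deriv_nonpos_of_isLocalMax {g : ℝ → ℝ} {a : ℝ} (h : IsLocalMax g a)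
    (hc : ContinuousAt g a) : deriv (deriv g) a ≤ 0 := by
  by_contra! hpos
  have hmin := isLocalMin_of_deriv_deriv_pos hpos h.deriv_eq_zero hc
  have hconst : g =ᶠ[𝓝 a] fun _ => g a := by
    filter_upwards [h, hmin] with y h1 h2 using le_antisymm h1 h2
  have h0 : deriv g =ᶠ[𝓝 a] fun _ => (0:ℝ) := by
    filter_upwards [hconst.deriv] with y hy
    simpa using hy
  have := h0.deriv_eq
  simp at this
  linarith

theorem TwiceDiffAt.lap_nonpos_of_isLocalMax {n : ℕ} {f : Euc n → ℝ} {x : Euc n}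
    (hf : TwiceDiffAt f x) (h : IsLocalMax f x) : lap n f x ≤ 0 := by
  rw [lap_eq_sum_of_hasFDerivAt hf.2.hasFDerivAt]
  refine Finset.sum_nonpos fun i _ => ?_
  set e : Euc n := EuclideanSpace.single i 1
  let c : ℝ → Euc n := fun s => x + s • e
  have hc : ∀ s, HasDerivAt c e s := fun s => by
    have h := ((hasDerivAt_id s).smul_const e).const_add x
    rw [one_smul] at h
    exact h
  have hc0 : c 0 = x := by simp [c]
  have hct : Tendsto c (𝓝 0) (𝓝 x) := by
    have := (hc 0).continuousAt.tendsto
    rwa [hc0] at this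
  have hd : deriv (fun s => f (c s)) =ᶠ[𝓝 0] fun s => fderiv ℝ f (c s) e := by
    filter_upwards [hct.eventually hf.1] with s hs
    exact (hs.hasFDerivAt.comp_hasDerivAt s (hc s)).deriv
  have hdd : deriv (deriv fun s => f (c s)) 0 = fderiv ℝ (fderiv ℝ f) x e e := by
    rw [hd.deriv_eq]
    have h1 : HasFDerivAt (fderiv ℝ f) (fderiv ℝ (fderiv ℝ f) x) (c 0) := by
      rw [hc0]; exact hf.2.hasFDerivAt
    have h2 := (h1.comp_hasDerivAt 0 (hc 0)).clm_apply (hasDerivAt_const (0:ℝ) e)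
    simpa using h2.deriv
  rw [← hdd]
  refine deriv_deriv_nonpos_of_isLocalMax ?_ ?_
  · have : ∀ᶠ s in 𝓝 (0:ℝ), f (c s) ≤ f (c 0) := by
      rw [hc0]; exact hct.eventually h
    exact this
  · refine ContinuousAt.comp (f := c) (g := f) ?_ (hc 0).continuousAt
    rw [hc0]; exact hf.1.self_of_nhds.continuousAt

/-- Maximum principle for functions whose time derivative is nonpositive at spatial maxima. -/
theorem parabolic_maximum_principle {n : ℕ} {K D : Set (Euc n)} (hK : IsCompact K)
    (hD : IsOpen D) {a b : ℝ} {w : Euc n → ℝ → ℝ}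
    (hw : ContinuousOn (fun q : Euc n × ℝ => w q.1 q.2) (K ×ˢ Icc a b))
    (hinit : ∀ x ∈ K, w x a ≤ 0) (hlat : ∀ x ∈ K \ D, ∀ t ∈ Icc a b, w x t ≤ 0)
    (hmax : ∀ x ∈ D, ∀ t ∈ Ioc a b, ∃ d, HasDerivAt (w x) d t ∧
      (IsLocalMax (fun y => w y t) x → d ≤ 0)) (hDK : D ⊆ K) :
    ∀ x ∈ K, ∀ t ∈ Icc a b, w x t ≤ 0 := by
  intro x hx t ht
  refine le_of_forall_pos_le_add fun η hη => ?_
  rw [zero_add]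
  have hab : a ≤ b := ht.1.trans ht.2
  set δ : ℝ := η / (b - a + 1)
  have hδ : 0 < δ := by positivity
  have hcont : ContinuousOn (fun q : Euc n × ℝ => w q.1 q.2 - δ * (q.2 - a)) (K ×ˢ Icc a b) := by
    fun_prop
  obtain ⟨⟨x1, t1⟩, ⟨hx1, ht1⟩, hm⟩ := (hK.prod isCompact_Icc).exists_isMaxOn
    ⟨(x, t), hx, ht⟩ hcont
  simp only at hx1 ht1
  have hle : w x1 t1 - δ * (t1 - a) ≤ 0 := by
    by_contra! hpos
    have hta : a ≤ t1 := ht1.1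
    have hw1 : 0 < w x1 t1 := by nlinarith
    have hx1D : x1 ∈ D := by
      by_contra hn
      linarith [hlat x1 ⟨hx1, hn⟩ t1 ht1]
    have ht1a : a < t1 := by
      rcases hta.eq_or_lt with h | h
      · subst h; linarith [hinit x1 hx1]
      · exact h
    obtain ⟨d, hd, hd'⟩ := hmax x1 hx1D t1 ⟨ht1a, ht1.2⟩
    have hd0 : d ≤ 0 := by
      refine hd' ?_
      filter_upwards [hD.mem_nhds hx1D] with y hy
      have := hm (show (y, t1) ∈ K ×ˢ Icc a b from ⟨hDK hy, ht1⟩)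
      simpa using this
    have hev : ∀ᶠ s in 𝓝[<] t1, slope (w x1) t1 s ≥ δ := by
      have : Ioo a t1 ∈ 𝓝[<] t1 := Ioo_mem_nhdsLT ht1a
      filter_upwards [this] with s hs
      have := hm (show (x1, s) ∈ K ×ˢ Icc a b from ⟨hx1, hs.1.le, hs.2.le.trans ht1.2⟩)
      simp only [mem_ofPred_eq] at this
      rw [slope_def_field, ge_iff_le, ← neg_div_neg_eq, le_div_iff₀ (by linarith [hs.2])]
      linarith
    have hlim : Tendsto (slope (w x1) t1) (𝓝[<] t1) (𝓝 d) :=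
      (hasDerivAt_iff_tendsto_slope.1 hd).mono_left
        (nhdsWithin_mono _ fun s hs => ne_of_lt hs)
    linarith [ge_of_tendsto hlim hev]
  have h2 := hm (show (x, t) ∈ K ×ˢ Icc a b from ⟨hx, ht⟩)
  simp only [mem_ofPred_eq] at h2
  have h3 : δ * (t - a) ≤ η := by
    have : δ * (b - a + 1) = η :=
      div_mul_cancel₀ _ (by linarith)
    nlinarith [ht.2]
  linarith

/-- `v` is twice differentiable in space, differentiable in time, and satisfies
`∂ₜv ≤ Δv + F(∇v)` at `(x, t)`. -/
def IsSubAt {n : ℕ} (F : Euc n → ℝ) (v : Euc n → ℝ → ℝ) (x : Euc n) (t : ℝ) : Prop :=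
  TwiceDiffAt (fun y => v y t) x ∧
    ∃ d, HasDerivAt (v x) d t ∧ d ≤ lap n (fun y => v y t) x + F (gradient (fun y => v y t) x)

/-- `v` is twice differentiable in space, differentiable in time, and satisfies
`∂ₜv ≥ Δv + F(∇v)` at `(x, t)`. -/
def IsSuperAt {n : ℕ} (F : Euc n → ℝ) (v : Euc n → ℝ → ℝ) (x : Euc n) (t : ℝ) : Prop :=
  TwiceDiffAt (fun y => v y t) x ∧
    ∃ d, HasDerivAt (v x) d t ∧ lap n (fun y => v y t) x + F (gradient (fun y => v y t) x) ≤ d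

theorem parabolic_comparison {n : ℕ} {F : Euc n → ℝ} {K D : Set (Euc n)} (hK : IsCompact K)
    (hD : IsOpen D) (hDK : D ⊆ K) {a b : ℝ} {u v : Euc n → ℝ → ℝ}
    (hv : ContinuousOn (fun q : Euc n × ℝ => v q.1 q.2) (K ×ˢ Icc a b))
    (hu : ContinuousOn (fun q : Euc n × ℝ => u q.1 q.2) (K ×ˢ Icc a b))
    (hinit : ∀ x ∈ K, v x a ≤ u x a) (hlat : ∀ x ∈ K \ D, ∀ t ∈ Icc a b, v x t ≤ u x t)
    (hsub : ∀ x ∈ D, ∀ t ∈ Ioc a b, IsSubAt F v x t)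
    (hsup : ∀ x ∈ D, ∀ t ∈ Ioc a b, IsSuperAt F u x t) :
    ∀ x ∈ K, ∀ t ∈ Icc a b, v x t ≤ u x t := by
  have := parabolic_maximum_principle hK hD (a := a) (b := b) (w := fun x t => v x t - u x t)
    (hv.sub hu) (fun x hx => by linarith [hinit x hx])
    (fun x hx t ht => by linarith [hlat x hx t ht]) ?_ hDK
  · exact fun x hx t ht => by linarith [this x hx t ht]
  intro x hx t ht
  obtain ⟨h1, d1, hd1, hd1'⟩ := hsub x hx t ht
  obtain ⟨h2, d2, hd2, hd2'⟩ := hsup x hx t ht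
  refine ⟨d1 - d2, hd1.sub hd2, fun hmax => ?_⟩
  obtain ⟨h3, h4⟩ := h1.sub h2
  have h5 := h3.lap_nonpos_of_isLocalMax hmax
  have h6 := hmax.fderiv_eq_zero
  rw [fderiv_fun_sub h1.1.self_of_nhds h2.1.self_of_nhds, sub_eq_zero] at h6
  have h7 : gradient (fun y => v y t) x = gradient (fun y => u y t) x := by
    simp only [gradient, h6]
  rw [h7] at hd1'
  linarith

/-- The inner product on `ℝⁿ` as a continuous bilinear form. -/
def innerForm (n : ℕ) : Euc n →L[ℝ] Euc n →L[ℝ] ℝ :=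
  innerSL ℝ

@[simp]
theorem innerForm_apply {n : ℕ} (x y : Euc n) : innerForm n x y = inner ℝ x y :=
  rfl

theorem hasFDerivAt_comp_norm_sub_sq {n : ℕ} {ψ : ℝ → ℝ} {d : ℝ} {c x : Euc n}
    (h : HasDerivAt ψ d (‖x - c‖ ^ 2)) :
    HasFDerivAt (fun y => ψ (‖y - c‖ ^ 2)) ((2 * d) • innerForm n (x - c)) x := by
  have h1 : HasFDerivAt (fun y : Euc n => ‖y - c‖ ^ 2)
      (2 • (innerSL ℝ (x - c)).comp (ContinuousLinearMap.id ℝ (Euc n))) x :=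
    ((hasFDerivAt_id x).sub_const c).norm_sq
  refine (h.comp_hasFDerivAt x h1).congr_fderiv ?_
  ext v
  simp
  ring

/-- The second derivative of a radial function `ψ(‖x - c‖²)`, in terms of `z = x - c`,
`d₁ = ψ'(‖z‖²)` and `d₂ = ψ''(‖z‖²)`. -/
def radialHessian {n : ℕ} (d₁ d₂ : ℝ) (z : Euc n) : Euc n →L[ℝ] Euc n →L[ℝ] ℝ :=
  (2 * d₁) • innerForm n + (4 * d₂) • (innerForm n z).smulRight (innerForm n z)

theorem sum_radialHessian {n : ℕ} (d₁ d₂ : ℝ) (z : Euc n) :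
    ∑ i : Fin n, radialHessian d₁ d₂ z (EuclideanSpace.single i 1) (EuclideanSpace.single i 1) =
      4 * ‖z‖ ^ 2 * d₂ + 2 * n * d₁ := by
  simp only [radialHessian, add_apply, smul_apply,
    ContinuousLinearMap.smulRight_apply, innerForm_apply, smul_eq_mul,
    EuclideanSpace.inner_single_right, Finset.sum_add_distrib, EuclideanSpace.norm_sq_eq]
  simp only [Real.norm_eq_abs, sq_abs, Finset.mul_sum, Finset.sum_mul]
  simp
  rw [add_comm]
  congr 1
  · exact Finset.sum_congr rfl fun i _ => by ring
  · ring

theorem hasFDerivAt_smul_innerSL {n : ℕ} {ψ' : ℝ → ℝ} {d : ℝ} {c x : Euc n}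
    (h : HasDerivAt ψ' d (‖x - c‖ ^ 2)) :
    HasFDerivAt (fun y => (2 * ψ' (‖y - c‖ ^ 2)) • innerForm n (y - c))
      (radialHessian (ψ' (‖x - c‖ ^ 2)) d (x - c)) x := by
  have h1 := (hasFDerivAt_comp_norm_sub_sq h).const_mul 2
  have h2 : HasFDerivAt (fun y : Euc n => innerForm n (y - c))
      (innerForm n) x := by
    have := (innerForm n).hasFDerivAt.comp x
      ((hasFDerivAt_id x).sub_const c)
    exact this
  refine (h1.smul h2).congr_fderiv ?_
  ext v w
  simp [radialHessian]
  ring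

theorem radial_jet {n : ℕ} {ψ ψ' : ℝ → ℝ} {d : ℝ} {c x : Euc n}
    (h : ∀ᶠ ρ in 𝓝 (‖x - c‖ ^ 2), HasDerivAt ψ (ψ' ρ) ρ) (h' : HasDerivAt ψ' d (‖x - c‖ ^ 2)) :
    TwiceDiffAt (fun y => ψ (‖y - c‖ ^ 2)) x ∧
      lap n (fun y => ψ (‖y - c‖ ^ 2)) x = 4 * ‖x - c‖ ^ 2 * d + 2 * n * ψ' (‖x - c‖ ^ 2) ∧
      gradient (fun y => ψ (‖y - c‖ ^ 2)) x = (2 * ψ' (‖x - c‖ ^ 2)) • (x - c) := by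
  have hcont : Tendsto (fun y : Euc n => ‖y - c‖ ^ 2) (𝓝 x) (𝓝 (‖x - c‖ ^ 2)) :=
    Continuous.tendsto (by fun_prop) x
  obtain ⟨h1, h2⟩ := TwiceDiffAt.of_hasFDerivAt
    ((hcont.eventually h).mono fun y hy => hasFDerivAt_comp_norm_sub_sq hy)
    (hasFDerivAt_smul_innerSL h')
  refine ⟨h1, ?_, ?_⟩
  · rw [lap_eq_sum_of_hasFDerivAt h2, sum_radialHessian]
  · refine HasGradientAt.gradient ?_
    rw [hasGradientAt_iff_hasFDerivAt]
    refine (hasFDerivAt_comp_norm_sub_sq h.self_of_nhds).congr_fderiv ?_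
    ext v
    simp

theorem exists_nhds_bound_of_continuousOn {n : ℕ} {P F : Type*} [NormedAddCommGroup P]
    [ProperSpace P] [NormedAddCommGroup F] {K : Set (Euc n)} (hK : IsCompact K) {U : Set P}
    (hU : IsOpen U) {G : P → Euc n → F}
    (hG : ContinuousOn (fun q : P × Euc n => G q.1 q.2) (U ×ˢ univ)) {p : P} (hp : p ∈ U) :
    ∃ s ∈ 𝓝 p, s ⊆ U ∧ ∃ C, ∀ p' ∈ s, ∀ y ∈ K, ‖G p' y‖ ≤ C := by
  obtain ⟨r, hr, hrU⟩ := Metric.nhds_basis_closedBall.mem_iff.1 (hU.mem_nhds hp)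
  obtain ⟨C, hC⟩ := ((isCompact_closedBall p r).prod hK).exists_bound_of_continuousOn
    (hG.mono (prod_mono hrU (subset_univ _)))
  exact ⟨closedBall p r, closedBall_mem_nhds p hr, hrU, C, fun p' hp' y hy => hC (p', y) ⟨hp', hy⟩⟩

theorem continuousOn_smul_kernel {n : ℕ} {P F : Type*} [NormedAddCommGroup P]
    [NormedAddCommGroup F] [NormedSpace ℝ F] {K : Set (Euc n)}
    {f : Euc n → ℝ} (hf : ContinuousOn f K) {U : Set P} {G : P → Euc n → F}
    (hG : ContinuousOn (fun q : P × Euc n => G q.1 q.2) (U ×ˢ univ)) {p : P} (hp : p ∈ U) :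
    ContinuousOn (fun y => f y • G p y) K :=
  hf.smul (hG.comp (f := fun y => (p, y)) (by fun_prop) fun y _ => ⟨hp, mem_univ _⟩)

theorem continuousAt_setIntegral_smul {n : ℕ} {P F : Type*} [NormedAddCommGroup P]
    [ProperSpace P] [NormedAddCommGroup F] [NormedSpace ℝ F] {K : Set (Euc n)}
    (hK : IsCompact K) {f : Euc n → ℝ} (hf : ContinuousOn f K) {U : Set P} (hU : IsOpen U)
    {G : P → Euc n → F} (hG : ContinuousOn (fun q : P × Euc n => G q.1 q.2) (U ×ˢ univ))
    {p : P} (hp : p ∈ U) :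
    ContinuousAt (fun p => ∫ y in K, f y • G p y) p := by
  obtain ⟨s, hs, hsU, C, hC⟩ := exists_nhds_bound_of_continuousOn hK hU hG hp
  refine continuousAt_of_dominated (bound := fun y => ‖f y‖ * C) ?_ ?_ ?_ ?_
  · filter_upwards [hU.mem_nhds hp] with p' hp'
    exact (continuousOn_smul_kernel hf hG hp').aestronglyMeasurable
      hK.measurableSet
  · filter_upwards [hs] with p' hp'
    refine (ae_restrict_iff' hK.measurableSet).2 (Eventually.of_forall fun y hy => ?_)
    rw [norm_smul]
    exact mul_le_mul_of_nonneg_left (hC p' hp' y hy) (norm_nonneg _)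
  · exact (hf.norm.mul continuousOn_const).integrableOn_compact hK
  · refine Eventually.of_forall fun y => ContinuousAt.const_smul ?_ _
    have h1 : ContinuousAt (fun q : P × Euc n => G q.1 q.2) (p, y) :=
      hG.continuousAt (prod_mem_nhds (hU.mem_nhds hp) univ_mem)
    exact ContinuousAt.comp (f := fun p' : P => (p', y)) h1 (by fun_prop)

theorem hasFDerivAt_setIntegral_smul {n : ℕ} {P F : Type*} [NormedAddCommGroup P]
    [NormedSpace ℝ P] [ProperSpace P] [NormedAddCommGroup F] [NormedSpace ℝ F]
    {K : Set (Euc n)} (hK : IsCompact K) {f : Euc n → ℝ} (hf : ContinuousOn f K) {U : Set P}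
    (hU : IsOpen U) {G : P → Euc n → F} {G' : P → Euc n → P →L[ℝ] F}
    (hG : ContinuousOn (fun q : P × Euc n => G q.1 q.2) (U ×ˢ univ))
    (hG' : ContinuousOn (fun q : P × Euc n => G' q.1 q.2) (U ×ˢ univ))
    (hd : ∀ p ∈ U, ∀ y, HasFDerivAt (fun p => G p y) (G' p y) p) {p : P} (hp : p ∈ U) :
    HasFDerivAt (fun p => ∫ y in K, f y • G p y) (∫ y in K, f y • G' p y) p := by
  obtain ⟨s, hs, hsU, C, hC⟩ := exists_nhds_bound_of_continuousOn hK hU hG' hp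
  refine hasFDerivAt_integral_of_dominated_of_fderiv_le (𝕜 := ℝ)
    (F := fun p y => f y • G p y) (F' := fun p y => f y • G' p y) (bound := fun y => ‖f y‖ * C) hs
    ?_ ?_ ?_ ?_ ?_ ?_
  · filter_upwards [hU.mem_nhds hp] with p' hp'
    exact (continuousOn_smul_kernel hf hG hp').aestronglyMeasurable
      hK.measurableSet
  · exact (continuousOn_smul_kernel hf hG hp).integrableOn_compact hK
  · exact (continuousOn_smul_kernel hf hG' hp).aestronglyMeasurable
      hK.measurableSet
  · refine (ae_restrict_iff' hK.measurableSet).2 (Eventually.of_forall fun y hy p' hp' => ?_)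
    rw [norm_smul]
    exact mul_le_mul_of_nonneg_left (hC p' hp' y hy) (norm_nonneg _)
  · exact (hf.norm.mul continuousOn_const).integrableOn_compact hK
  · exact Eventually.of_forall fun y p' hp' => (hd p' (hsU hp') y).const_smul (f y)

/-- The heat kernel at time `σ`, as a function of the squared distance `ρ`. -/
def heat (n : ℕ) (σ ρ : ℝ) : ℝ :=
  (4 * Real.pi * σ) ^ (-(n : ℝ) / 2) * Real.exp (-ρ / (4 * σ))

theorem heat_pos {n : ℕ} {σ : ℝ} (hσ : 0 < σ) (ρ : ℝ) : 0 < heat n σ ρ := by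
  unfold heat
  positivity

theorem hasDerivAt_heat_sq_dist {n : ℕ} (σ ρ : ℝ) :
    HasDerivAt (heat n σ) (-(1 / (4 * σ)) * heat n σ ρ) ρ := by
  have h1 : HasDerivAt (fun ρ : ℝ => -ρ / (4 * σ)) (-1 / (4 * σ)) ρ :=
    (hasDerivAt_id ρ).neg.div_const _
  refine (h1.exp.const_mul ((4 * Real.pi * σ) ^ (-(n : ℝ) / 2))).congr_deriv ?_
  unfold heat
  ring

theorem hasDerivAt_heat_time {n : ℕ} {σ : ℝ} (hσ : 0 < σ) (ρ : ℝ) :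
    HasDerivAt (fun σ => heat n σ ρ) (heat n σ ρ * (ρ / (4 * σ ^ 2) - n / (2 * σ))) σ := by
  have h1 : HasDerivAt (fun σ : ℝ => 4 * Real.pi * σ) (4 * Real.pi) σ := by
    simpa using (hasDerivAt_id σ).const_mul (4 * Real.pi)
  have h2 := h1.rpow_const (p := -(n : ℝ) / 2) (Or.inl (by positivity))
  have h3 : HasDerivAt (fun σ : ℝ => -ρ / (4 * σ)) (ρ / (4 * σ ^ 2)) σ := by
    have := ((hasDerivAt_const σ (-ρ)).div ((hasDerivAt_id σ).const_mul 4) (by simp; positivity))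
    refine this.congr_deriv ?_
    simp
    field_simp
  refine (h2.mul h3.exp).congr_deriv ?_
  unfold heat
  rw [Real.rpow_sub_one (by positivity)]
  field_simp
  ring

theorem continuousOn_heat {n : ℕ} :
    ContinuousOn (fun q : ℝ × ℝ => heat n q.1 q.2) (Ioi 0 ×ˢ univ) := by
  unfold heat
  refine ContinuousOn.mul (ContinuousOn.rpow_const (by fun_prop) ?_)
    (Real.continuous_exp.comp_continuousOn (ContinuousOn.div (by fun_prop) (by fun_prop) ?_))
  · rintro ⟨σ, ρ⟩ ⟨hσ, -⟩
    have : 0 < σ := hσ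
    exact Or.inl (by positivity)
  · rintro ⟨σ, ρ⟩ ⟨hσ, -⟩
    have : 0 < σ := hσ
    simp
    positivity

@[fun_prop]
theorem continuous_heat {n : ℕ} (σ : ℝ) : Continuous (heat n σ) :=
  continuous_iff_continuousAt.2 fun ρ => (hasDerivAt_heat_sq_dist σ ρ).continuousAt

/-- The superposition `∫_K f(y) Φ_τ(x - y) dy` of heat kernels. -/
def heatPotential {n : ℕ} (K : Set (Euc n)) (f : Euc n → ℝ) (x : Euc n) (τ : ℝ) : ℝ :=
  ∫ y in K, f y • heat n τ (‖x - y‖ ^ 2)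

theorem continuousAt_heatPotential {n : ℕ} {K : Set (Euc n)} (hK : IsCompact K)
    {f : Euc n → ℝ} (hf : ContinuousOn f K) (x : Euc n) {τ : ℝ} (hτ : 0 < τ) :
    ContinuousAt (fun q : Euc n × ℝ => heatPotential K f q.1 q.2) (x, τ) := by
  refine continuousAt_setIntegral_smul hK hf (U := univ ×ˢ Ioi 0) (isOpen_univ.prod isOpen_Ioi)
    (G := fun q y => heat n q.2 (‖q.1 - y‖ ^ 2)) ?_ ⟨mem_univ _, hτ⟩
  exact continuousOn_heat.comp (f := fun q : (Euc n × ℝ) × Euc n => (q.1.2, ‖q.1.1 - q.2‖ ^ 2))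
    (by fun_prop) fun q hq => ⟨hq.1.2, mem_univ _⟩

theorem hasDerivAt_heatPotential_time {n : ℕ} {K : Set (Euc n)} (hK : IsCompact K)
    {f : Euc n → ℝ} (hf : ContinuousOn f K) (x : Euc n) {τ : ℝ} (hτ : 0 < τ) :
    HasDerivAt (heatPotential K f x) (∫ y in K, f y •
      (heat n τ (‖x - y‖ ^ 2) * (‖x - y‖ ^ 2 / (4 * τ ^ 2) - n / (2 * τ)))) τ := by
  have hc : ContinuousOn (fun q : ℝ × Euc n => heat n q.1 (‖x - q.2‖ ^ 2)) (Ioi 0 ×ˢ univ) :=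
    continuousOn_heat.comp (f := fun q : ℝ × Euc n => (q.1, ‖x - q.2‖ ^ 2))
      (by fun_prop) fun q hq => ⟨hq.1, mem_univ _⟩
  have hc' : ContinuousOn (fun q : ℝ × Euc n => heat n q.1 (‖x - q.2‖ ^ 2) *
      (‖x - q.2‖ ^ 2 / (4 * q.1 ^ 2) - n / (2 * q.1))) (Ioi 0 ×ˢ univ) := by
    refine hc.mul (ContinuousOn.sub (ContinuousOn.div (by fun_prop) (by fun_prop) ?_)
      (ContinuousOn.div (by fun_prop) (by fun_prop) ?_)) <;>
    · rintro ⟨σ, ρ⟩ ⟨hσ, -⟩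
      have : 0 < σ := hσ
      positivity
  have h1 := hasFDerivAt_setIntegral_smul hK hf (U := Ioi (0 : ℝ)) isOpen_Ioi
    (G := fun σ y => heat n σ (‖x - y‖ ^ 2))
    (G' := fun σ y => (heat n σ (‖x - y‖ ^ 2) * (‖x - y‖ ^ 2 / (4 * σ ^ 2) - n / (2 * σ))) •
      ContinuousLinearMap.id ℝ ℝ) hc (hc'.smul continuousOn_const)
    (fun σ hσ y => (hasDerivAt_heat_time hσ _).hasFDerivAt.congr_fderiv (by ext; simp)) hτ
  refine h1.hasDerivAt.congr_deriv ?_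
  rw [ContinuousLinearMap.integral_apply]
  · simp
  · exact (continuousOn_smul_kernel hf (U := Ioi (0 : ℝ))
      (G := fun σ y => (heat n σ (‖x - y‖ ^ 2) * (‖x - y‖ ^ 2 / (4 * σ ^ 2) - n / (2 * σ))) •
        ContinuousLinearMap.id ℝ ℝ) (hc'.smul continuousOn_const) hτ).integrableOn_compact hK

theorem continuous_smul_add_smul {α F : Type*} [TopologicalSpace α] [NormedAddCommGroup F]
    [NormedSpace ℝ F] {B : F} {c d : α → ℝ} {W : α → F} (hc : Continuous c) (hd : Continuous d)
    (hW : Continuous W) : Continuous fun a => c a • B + d a • W a :=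
  (hc.smul continuous_const).add (hd.smul hW)

theorem continuous_smul_add_smul_smulRight {α E : Type*} [TopologicalSpace α]
    [NormedAddCommGroup E] [NormedSpace ℝ E] {B : E →L[ℝ] E →L[ℝ] ℝ} {c d : α → ℝ}
    {L : α → E →L[ℝ] ℝ} (hc : Continuous c) (hd : Continuous d) (hL : Continuous L) :
    Continuous fun a => c a • B + d a • (L a).smulRight (L a) := by
  have : Continuous fun a => (L a).smulRight (L a) :=
    ((ContinuousLinearMap.smulRightL ℝ E (E →L[ℝ] ℝ)).continuous₂).comp (hL.prodMk hL)
  exact continuous_smul_add_smul (F := E →L[ℝ] E →L[ℝ] ℝ) hc hd this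

theorem continuous_radialHessian {n : ℕ} {α : Type*} [TopologicalSpace α] {d₁ d₂ : α → ℝ}
    {z : α → Euc n} (h₁ : Continuous d₁) (h₂ : Continuous d₂) (hz : Continuous z) :
    Continuous fun a => radialHessian (d₁ a) (d₂ a) (z a) :=
  continuous_smul_add_smul_smulRight (continuous_const.mul h₁) (continuous_const.mul h₂)
    (by fun_prop)

theorem setIntegral_smul_apply {n : ℕ} {P F : Type*} [NormedAddCommGroup P] [NormedSpace ℝ P]
    [NormedAddCommGroup F] [NormedSpace ℝ F] [CompleteSpace F] {K : Set (Euc n)}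
    (hK : IsCompact K) {f : Euc n → ℝ} (hf : ContinuousOn f K) {G : Euc n → P →L[ℝ] F}
    (hG : Continuous G) (v : P) :
    (∫ y in K, f y • G y) v = ∫ y in K, f y • G y v := by
  rw [ContinuousLinearMap.integral_apply]
  · rfl
  · exact (hf.smul hG.continuousOn).integrableOn_compact hK

theorem heatPotential_space {n : ℕ} {K : Set (Euc n)} (hK : IsCompact K)
    {f : Euc n → ℝ} (hf : ContinuousOn f K) (x : Euc n) {τ : ℝ} (hτ : 0 < τ) :
    TwiceDiffAt (fun x => heatPotential K f x τ) x ∧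
      lap n (fun x => heatPotential K f x τ) x = ∫ y in K, f y •
        (heat n τ (‖x - y‖ ^ 2) * (‖x - y‖ ^ 2 / (4 * τ ^ 2) - n / (2 * τ))) := by
  set ψ' : ℝ → ℝ := fun ρ => -(1 / (4 * τ)) * heat n τ ρ with hψ'
  have hψc : Continuous ψ' := by fun_prop
  have hd1 : ∀ ρ, HasDerivAt (heat n τ) (ψ' ρ) ρ := hasDerivAt_heat_sq_dist τ
  have hd2 : ∀ ρ, HasDerivAt ψ' (-(1 / (4 * τ)) * ψ' ρ) ρ := fun ρ => (hd1 ρ).const_mul _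
  have hH : Continuous fun q : Euc n × Euc n => radialHessian (ψ' (‖q.1 - q.2‖ ^ 2))
      (-(1 / (4 * τ)) * ψ' (‖q.1 - q.2‖ ^ 2)) (q.1 - q.2) :=
    continuous_radialHessian (by fun_prop) (by fun_prop) (by fun_prop)
  have hG1 : Continuous fun q : Euc n × Euc n =>
      (2 * ψ' (‖q.1 - q.2‖ ^ 2)) • innerForm n (q.1 - q.2) := by fun_prop
  have h1 : ∀ x, HasFDerivAt (fun x => heatPotential K f x τ)
      (∫ y in K, f y • (2 * ψ' (‖x - y‖ ^ 2)) • innerForm n (x - y)) x := fun x =>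
    hasFDerivAt_setIntegral_smul hK hf (U := univ) isOpen_univ
      (G := fun x y => heat n τ (‖x - y‖ ^ 2))
      (G' := fun x y => (2 * ψ' (‖x - y‖ ^ 2)) • innerForm n (x - y))
      (Continuous.continuousOn (by fun_prop)) hG1.continuousOn
      (fun x _ y => hasFDerivAt_comp_norm_sub_sq (hd1 _)) (mem_univ x)
  have h2 := hasFDerivAt_setIntegral_smul hK hf (U := univ) isOpen_univ
      (G := fun x y => (2 * ψ' (‖x - y‖ ^ 2)) • innerForm n (x - y))
      (G' := fun x y => radialHessian (ψ' (‖x - y‖ ^ 2))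
        (-(1 / (4 * τ)) * ψ' (‖x - y‖ ^ 2)) (x - y)) hG1.continuousOn hH.continuousOn
      (fun x _ y => hasFDerivAt_smul_innerSL (hd2 _)) (mem_univ x)
  obtain ⟨h3, h4⟩ := TwiceDiffAt.of_hasFDerivAt (Eventually.of_forall h1) h2
  refine ⟨h3, ?_⟩
  rw [lap_eq_sum_of_hasFDerivAt h4]
  have hHx : Continuous fun y : Euc n => radialHessian (ψ' (‖x - y‖ ^ 2))
      (-(1 / (4 * τ)) * ψ' (‖x - y‖ ^ 2)) (x - y) :=
    continuous_radialHessian (by fun_prop) (by fun_prop) (by fun_prop)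
  have hHv : ∀ v : Euc n, Continuous fun y : Euc n => radialHessian (ψ' (‖x - y‖ ^ 2))
      (-(1 / (4 * τ)) * ψ' (‖x - y‖ ^ 2)) (x - y) v := fun v => by fun_prop
  simp_rw [setIntegral_smul_apply hK hf hHx, setIntegral_smul_apply hK hf (hHv _)]
  refine (integral_finsetSum _ fun i _ => ContinuousOn.integrableOn_compact hK (hf.smul
    (Continuous.continuousOn ((hHv _).clm_apply continuous_const)))).symm.trans ?_
  refine integral_congr_ae (Eventually.of_forall fun y => ?_)
  simp only [Pi.smul_apply', ← Finset.smul_sum, sum_radialHessian, hψ']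
  congr 1
  field_simp
  ring

theorem hasDerivAt_heatPotential_lap {n : ℕ} {K : Set (Euc n)} (hK : IsCompact K)
    {f : Euc n → ℝ} (hf : ContinuousOn f K) (x : Euc n) {τ : ℝ} (hτ : 0 < τ) :
    HasDerivAt (heatPotential K f x) (lap n (fun x => heatPotential K f x τ) x) τ := by
  rw [(heatPotential_space hK hf x hτ).2]
  exact hasDerivAt_heatPotential_time hK hf x hτ

theorem heat_antitone {n : ℕ} {σ : ℝ} (hσ : 0 < σ) : Antitone (heat n σ) := by
  intro a b hab
  unfold heat
  gcongr

theorem heat_mono_time {n : ℕ} {σ σ' ρ : ℝ} (hσ : 0 < σ) (h : σ ≤ σ') (hρ : 2 * n * σ' ≤ ρ) :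
    heat n σ ρ ≤ heat n σ' ρ := by
  have hd : ∀ s ∈ Icc σ σ', HasDerivAt (fun σ => heat n σ ρ)
      (heat n s ρ * (ρ / (4 * s ^ 2) - n / (2 * s))) s := fun s hs =>
    hasDerivAt_heat_time (hσ.trans_le hs.1) ρ
  refine monotoneOn_of_deriv_nonneg (convex_Icc σ σ')
    (fun s hs => (hd s hs).continuousAt.continuousWithinAt)
    (fun s hs => (hd s (interior_subset hs)).differentiableAt.differentiableWithinAt)
    (fun s hs => ?_) (left_mem_Icc.2 h) (right_mem_Icc.2 h) h
  have hs' := interior_subset hs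
  have hs0 : 0 < s := hσ.trans_le hs'.1
  rw [(hd s hs').deriv]
  refine mul_nonneg (heat_pos hs0 ρ).le ?_
  have h1 : 2 * n * s ≤ ρ := le_trans (by gcongr; exact hs'.2) hρ
  rw [sub_nonneg, div_le_div_iff₀ (by positivity) (by positivity)]
  nlinarith

theorem exists_heat_le_sq {n : ℕ} {δ : ℝ} (hδ : 0 < δ) :
    ∃ C, 0 ≤ C ∧ ∀ τ ∈ Ioc (0 : ℝ) 1, ∀ ρ, δ ≤ ρ → heat n τ ρ ≤ C * τ ^ 2 := by
  refine ⟨(n + 2).factorial * (4 / δ) ^ (n + 2), by positivity, fun τ hτ ρ hρ => ?_⟩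
  have hτ0 : 0 < τ := hτ.1
  have h1 : Real.exp (-ρ / (4 * τ)) ≤ (n + 2).factorial * (4 / δ) ^ (n + 2) * τ ^ (n + 2) := by
    have h2 := Real.pow_div_factorial_le_exp (δ / (4 * τ)) (by positivity) (n + 2)
    calc Real.exp (-ρ / (4 * τ)) ≤ Real.exp (-(δ / (4 * τ))) := by
          rw [← neg_div]
          gcongr
      _ = (Real.exp (δ / (4 * τ)))⁻¹ := Real.exp_neg _
      _ ≤ ((δ / (4 * τ)) ^ (n + 2) / (n + 2).factorial)⁻¹ := by gcongr
      _ = (n + 2).factorial * (4 / δ) ^ (n + 2) * τ ^ (n + 2) := by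
          have h3 : δ / (4 * τ) * (4 / δ) * τ = 1 := by field_simp
          field_simp
          rw [← mul_pow, ← mul_pow, h3, one_pow]
  have h3 : (4 * Real.pi * τ) ^ (-(n : ℝ) / 2) ≤ (τ ^ n)⁻¹ := by
    calc (4 * Real.pi * τ) ^ (-(n : ℝ) / 2) ≤ τ ^ (-(n : ℝ) / 2) := by
          refine Real.rpow_le_rpow_of_nonpos hτ0 ?_ ?_
          · nlinarith [Real.pi_gt_three]
          · have : (0 : ℝ) ≤ n := n.cast_nonneg
            linarith
      _ ≤ τ ^ (-(n : ℝ)) := by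
          refine Real.rpow_le_rpow_of_exponent_ge hτ0 hτ.2 ?_
          have : (0 : ℝ) ≤ n := n.cast_nonneg
          linarith
      _ = (τ ^ n)⁻¹ := by rw [Real.rpow_neg hτ0.le, Real.rpow_natCast]
  calc heat n τ ρ ≤ (τ ^ n)⁻¹ * ((n + 2).factorial * (4 / δ) ^ (n + 2) * τ ^ (n + 2)) := by
        unfold heat
        gcongr
    _ = _ := by
        field_simp
        ring

theorem integral_exp_neg_mul_norm_sub_sq {n : ℕ} {b : ℝ} (hb : 0 < b) (c : Euc n) :
    Integrable (fun x : Euc n => Real.exp (-b * ‖x - c‖ ^ 2)) ∧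
      ∫ x : Euc n, Real.exp (-b * ‖x - c‖ ^ 2) = (Real.pi / b) ^ ((n : ℝ) / 2) := by
  have h := GaussianFourier.integral_rexp_neg_mul_sq_norm (V := Euc n) hb
  rw [finrank_euclideanSpace_fin] at h
  have hi : Integrable fun x : Euc n => Real.exp (-b * ‖x‖ ^ 2) := by
    refine not_imp_comm.1 integral_undef ?_
    rw [h]
    positivity
  refine ⟨hi.comp_sub_right c, ?_⟩
  rw [integral_sub_right_eq_self (fun x : Euc n => Real.exp (-b * ‖x‖ ^ 2)) c, h]

theorem heat_eq_exp {n : ℕ} {σ : ℝ} (x c : Euc n) : heat n σ (‖x - c‖ ^ 2) =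
    (4 * Real.pi * σ) ^ (-(n : ℝ) / 2) * Real.exp (-(1 / (4 * σ)) * ‖x - c‖ ^ 2) := by
  unfold heat
  ring_nf

theorem integrable_heat {n : ℕ} {σ : ℝ} (hσ : 0 < σ) (c : Euc n) :
    Integrable fun x : Euc n => heat n σ (‖x - c‖ ^ 2) := by
  simp_rw [heat_eq_exp]
  exact (integral_exp_neg_mul_norm_sub_sq (by positivity) c).1.const_mul _

theorem integral_heat {n : ℕ} {σ : ℝ} (hσ : 0 < σ) (c : Euc n) :
    ∫ x : Euc n, heat n σ (‖x - c‖ ^ 2) = 1 := by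
  simp_rw [heat_eq_exp]
  rw [integral_const_mul, (integral_exp_neg_mul_norm_sub_sq (by positivity) c).2, neg_div,
    Real.rpow_neg (by positivity), div_div_eq_mul_div, div_one]
  rw [show Real.pi * (4 * σ) = 4 * Real.pi * σ by ring]
  exact inv_mul_cancel₀ (by positivity)

theorem heat_mul_heat {n : ℕ} {h σ : ℝ} (hh : 0 < h) (hσ : 0 < σ) (x y : Euc n) :
    heat n h (‖x - y‖ ^ 2) * heat n σ (‖x‖ ^ 2) =
      heat n (h + σ) (‖y‖ ^ 2) * heat n (h * σ / (h + σ)) (‖x - (σ / (h + σ)) • y‖ ^ 2) := by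
  have h0 : 0 < h + σ := by positivity
  unfold heat
  rw [mul_mul_mul_comm, mul_mul_mul_comm _ (Real.exp _), ← Real.mul_rpow (by positivity)
    (by positivity), ← Real.mul_rpow (by positivity) (by positivity), ← Real.exp_add,
    ← Real.exp_add]
  congr 2
  · field_simp
  · rw [norm_sub_sq_real, norm_sub_sq_real, inner_smul_right, norm_smul, mul_pow,
      Real.norm_eq_abs, sq_abs]
    field_simp
    ring

theorem integral_heat_mul_heat {n : ℕ} {h σ : ℝ} (hh : 0 < h) (hσ : 0 < σ) (y : Euc n) :
    Integrable (fun x : Euc n => heat n h (‖x - y‖ ^ 2) * heat n σ (‖x‖ ^ 2)) ∧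
      ∫ x : Euc n, heat n h (‖x - y‖ ^ 2) * heat n σ (‖x‖ ^ 2) = heat n (h + σ) (‖y‖ ^ 2) := by
  simp_rw [heat_mul_heat hh hσ]
  refine ⟨(integrable_heat (by positivity) _).const_mul _, ?_⟩
  rw [integral_const_mul, integral_heat (by positivity), mul_one]

theorem TwiceDiffAt.sub_const {n : ℕ} {f : Euc n → ℝ} {x : Euc n} (h : TwiceDiffAt f x) (c : ℝ) :
    TwiceDiffAt (fun y => f y - c) x ∧ lap n (fun y => f y - c) x = lap n f x ∧
      gradient (fun y => f y - c) x = gradient f x := by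
  have h1 : fderiv ℝ (fun y => f y - c) = fderiv ℝ f := by
    ext y : 1
    exact fderiv_sub_const c
  refine ⟨⟨h.1.mono fun y hy => hy.sub_const c, by rw [h1]; exact h.2⟩, ?_, ?_⟩
  · simp only [lap, h1]
  · simp only [gradient, h1]

theorem IsSubAt.sub_const {n : ℕ} {F : Euc n → ℝ} {v : Euc n → ℝ → ℝ} {x : Euc n} {t : ℝ}
    (h : IsSubAt F v x t) (c : ℝ) : IsSubAt F (fun x t => v x t - c) x t := by
  obtain ⟨h1, d, hd, hd'⟩ := h
  obtain ⟨h2, h3, h4⟩ := h1.sub_const c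
  refine ⟨h2, d, hd.sub_const c, ?_⟩
  rw [h3, h4]
  exact hd'

theorem IsSubAt.comp_add_const {n : ℕ} {F : Euc n → ℝ} {v : Euc n → ℝ → ℝ} {x : Euc n} {t s : ℝ}
    (h : IsSubAt F v x (t + s)) : IsSubAt F (fun x t => v x (t + s)) x t := by
  obtain ⟨h1, d, hd, hd'⟩ := h
  exact ⟨h1, d, hd.comp_add_const t s, hd'⟩

theorem isSubAt_heatPotential {n : ℕ} {K : Set (Euc n)} (hK : IsCompact K)
    {f : Euc n → ℝ} (hf : ContinuousOn f K) (x : Euc n) {τ : ℝ} (hτ : 0 < τ) :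
    IsSubAt (fun _ => 0) (heatPotential K f) x τ :=
  ⟨(heatPotential_space hK hf x hτ).1, _, hasDerivAt_heatPotential_lap hK hf x hτ, by simp⟩

/-- Nonnegative supersolutions of the heat equation in the unit ball which are continuous up to
the boundary and bounded by `S`. -/
structure IsHeatSuper (n : ℕ) (S : ℝ) (u : Euc n → ℝ → ℝ) : Prop where
  cont : ContinuousOn (fun q : Euc n × ℝ => u q.1 q.2) (closedBall 0 1 ×ˢ Ici 0)
  nonneg : ∀ x ∈ closedBall (0 : Euc n) 1, ∀ t, 0 ≤ t → 0 ≤ u x t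
  le : ∀ x ∈ closedBall (0 : Euc n) 1, ∀ t, 0 ≤ t → u x t ≤ S
  super : ∀ x ∈ ball (0 : Euc n) 1, ∀ t, 0 < t → IsSuperAt (fun _ => 0) u x t

theorem IsHeatSuper.continuousOn_space {n : ℕ} {S : ℝ} {u : Euc n → ℝ → ℝ}
    (hu : IsHeatSuper n S u) {t : ℝ} (ht : 0 ≤ t) {K : Set (Euc n)}
    (hK : K ⊆ closedBall 0 1) : ContinuousOn (fun x => u x t) K :=
  hu.cont.comp (f := fun x => (x, t)) (by fun_prop) fun _ hx => ⟨hK hx, ht⟩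

theorem IsHeatSuper.bound_nonneg {n : ℕ} {S : ℝ} {u : Euc n → ℝ → ℝ}
    (hu : IsHeatSuper n S u) : 0 ≤ S :=
  (hu.nonneg 0 (by simp) 0 le_rfl).trans (hu.le 0 (by simp) 0 le_rfl)

theorem IsHeatSuper.eventually_heatPotential_le {n : ℕ} {S : ℝ} {u : Euc n → ℝ → ℝ}
    (hu : IsHeatSuper n S u) {t : ℝ} (ht : 0 ≤ t) {K : Set (Euc n)} (hKc : IsCompact K)
    (hK : K ⊆ closedBall 0 1) {η : ℝ} (hη : 0 < η) :
    ∀ᶠ τ in 𝓝[>] (0 : ℝ), ∀ x ∈ closedBall (0 : Euc n) 1,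
      heatPotential K (fun y => u y t) x τ ≤ u x t + η := by
  have huc := (isCompact_closedBall (0 : Euc n) 1).uniformContinuousOn_of_continuous
    (hu.continuousOn_space ht Subset.rfl)
  obtain ⟨δ, hδ, hδu⟩ := Metric.uniformContinuousOn_iff.1 huc (η / 2) (by positivity)
  obtain ⟨C, hC0, hC⟩ := exists_heat_le_sq (n := n) (δ := δ ^ 2) (by positivity)
  have hS := hu.bound_nonneg
  have hlim : Tendsto (fun τ : ℝ => S * (C * τ ^ 2) * volume.real K) (𝓝[>] 0) (𝓝 0) := by
    have : Tendsto (fun τ : ℝ => S * (C * τ ^ 2) * volume.real K) (𝓝 0)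
        (𝓝 (S * (C * 0 ^ 2) * volume.real K)) := Continuous.tendsto (by fun_prop) 0
    simp only [ne_eq, OfNat.ofNat_ne_zero, not_false_eq_true, zero_pow, mul_zero, zero_mul] at this
    exact this.mono_left nhdsWithin_le_nhds
  filter_upwards [hlim.eventually (gt_mem_nhds (show (0 : ℝ) < η / 2 by positivity)),
    Ioc_mem_nhdsGT (show (0 : ℝ) < 1 by norm_num)] with τ hτs hτ x hx
  have hux := hu.nonneg x hx t ht
  have hpt : ∀ y ∈ K, u y t • heat n τ (‖x - y‖ ^ 2) ≤
      (u x t + η / 2) * heat n τ (‖y - x‖ ^ 2) + S * (C * τ ^ 2) := by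
    intro y hy
    rw [norm_sub_rev x y, smul_eq_mul]
    have hp := heat_pos (n := n) hτ.1 (‖y - x‖ ^ 2)
    rcases lt_or_ge (dist y x) δ with hd | hd
    · have h1 := hδu y (hK hy) x hx hd
      rw [Real.dist_eq, abs_lt] at h1
      have h2 : u y t ≤ u x t + η / 2 := by linarith
      have h3 : 0 ≤ S * (C * τ ^ 2) := by positivity
      nlinarith
    · have h1 : heat n τ (‖y - x‖ ^ 2) ≤ C * τ ^ 2 := by
        refine hC τ hτ _ ?_
        rw [← dist_eq_norm]
        gcongr
      have h2 := hu.le y (hK hy) t ht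
      have h3 : u y t * heat n τ (‖y - x‖ ^ 2) ≤ S * (C * τ ^ 2) := by gcongr
      have h4 : 0 ≤ (u x t + η / 2) * heat n τ (‖y - x‖ ^ 2) := by positivity
      linarith
  have hi1 : IntegrableOn (fun y => (u x t + η / 2) * heat n τ (‖y - x‖ ^ 2)) K :=
    ((integrable_heat hτ.1 x).const_mul _).integrableOn
  have hi2 : IntegrableOn (fun _ : Euc n => S * (C * τ ^ 2)) K :=
    integrableOn_const hKc.measure_lt_top.ne
  calc heatPotential K (fun y => u y t) x τ
      ≤ ∫ y in K, ((u x t + η / 2) * heat n τ (‖y - x‖ ^ 2) + S * (C * τ ^ 2)) := by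
        refine setIntegral_mono_on ?_ (hi1.add hi2) hKc.measurableSet hpt
        exact ((hu.continuousOn_space ht hK).smul
          (Continuous.continuousOn (by fun_prop))).integrableOn_compact hKc
    _ = (u x t + η / 2) * (∫ y in K, heat n τ (‖y - x‖ ^ 2)) + S * (C * τ ^ 2) * volume.real K := by
        rw [integral_add hi1 hi2, integral_const_mul, setIntegral_const, smul_eq_mul,
          mul_comm (volume.real K)]
    _ ≤ (u x t + η / 2) * 1 + η / 2 := by
        gcongr
        rw [← integral_heat hτ.1 x]
        exact setIntegral_le_integral (integrable_heat hτ.1 x)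
          (Eventually.of_forall fun y => (heat_pos hτ.1 _).le)
    _ = u x t + η := by ring

/-- Comparison of a supersolution with the heat flow of its restriction to a smaller ball, corrected
by a constant so as to be nonpositive on the boundary. -/
theorem IsHeatSuper.heatPotential_le {n : ℕ} {S : ℝ} {u : Euc n → ℝ → ℝ}
    (hu : IsHeatSuper n S u) {t h h' r A : ℝ} (ht : 0 ≤ t) (hh : 0 < h) (hh' : h < h')
    (hr : r ≤ 1) (hA : ∀ τ ∈ Ioc 0 h', ∀ ρ, (1 - r) ^ 2 ≤ ρ → heat n τ ρ ≤ A)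
    {x : Euc n} (hx : x ∈ closedBall (0 : Euc n) 1) :
    heatPotential (closedBall 0 r) (fun y => u y t) x h - A * ∫ y in closedBall 0 r, u y t ≤
      u x (t + h) := by
  set K := closedBall (0 : Euc n) r
  have hKc : IsCompact K := isCompact_closedBall 0 r
  have hK : K ⊆ closedBall 0 1 := closedBall_subset_closedBall hr
  have hf := hu.continuousOn_space ht hK
  have hf0 : ∀ y ∈ K, 0 ≤ u y t := fun y hy => hu.nonneg y (hK hy) t ht
  have hA0 : 0 ≤ A := (heat_pos (n := n) (hh.trans hh') _).le.trans
    (hA h' ⟨hh.trans hh', le_rfl⟩ _ le_rfl)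
  have hI0 : 0 ≤ A * ∫ y in K, u y t :=
    mul_nonneg hA0 (setIntegral_nonneg hKc.measurableSet hf0)
  refine le_of_forall_pos_le_add fun η hη => ?_
  have key : ∀ᶠ τ in 𝓝[>] (0 : ℝ), heatPotential K (fun y => u y t) x (h + τ) -
      ((A * ∫ y in K, u y t) + η) ≤ u x (t + h) := by
    filter_upwards [hu.eventually_heatPotential_le ht hKc hK hη,
      Ioc_mem_nhdsGT (sub_pos.2 hh')] with τ hτ hτ'
    have hτ0 : 0 < τ := hτ'.1
    have hcomp := parabolic_comparison (F := fun _ => 0) (isCompact_closedBall (0 : Euc n) 1)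
      (D := ball 0 1) isOpen_ball ball_subset_closedBall (a := t) (b := t + h) (u := u)
      (v := fun x s => heatPotential K (fun y => u y t) x (s + (τ - t)) -
        ((A * ∫ y in K, u y t) + η)) ?_ ?_ ?_ ?_ ?_ ?_ x hx (t + h)
        (right_mem_Icc.2 (by linarith))
    · simpa only [show t + h + (τ - t) = h + τ by ring] using hcomp
    · rintro ⟨z, s⟩ ⟨-, hs⟩
      refine ContinuousAt.continuousWithinAt (ContinuousAt.sub ?_ continuousAt_const)
      have := continuousAt_heatPotential hKc hf z (τ := s + (τ - t)) (by linarith [hs.1])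
      exact ContinuousAt.comp (x := (z, s)) (f := fun q : Euc n × ℝ => (q.1, q.2 + (τ - t)))
        (g := fun q : Euc n × ℝ => heatPotential K (fun y => u y t) q.1 q.2) this (by fun_prop)
    · exact hu.cont.mono (prod_mono Subset.rfl fun s hs => ht.trans hs.1)
    · intro z hz
      have := hτ z hz
      simp only [add_sub_cancel]
      linarith
    · intro z hz s hs
      have hz1 : ‖z‖ = 1 := by
        have h1 := hz.1
        have h2 := hz.2
        simp only [mem_closedBall, mem_ball, dist_zero_right, not_lt] at h1 h2
        exact le_antisymm h1 h2
      have hs0 : 0 < s + (τ - t) := by linarith [hs.1]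
      have h1 : heatPotential K (fun y => u y t) z (s + (τ - t)) ≤ A * ∫ y in K, u y t := by
        rw [← integral_const_mul]
        refine setIntegral_mono_on ?_ ((hf.integrableOn_compact hKc).const_mul _)
          hKc.measurableSet fun y hy => ?_
        · exact (hf.smul (Continuous.continuousOn (by fun_prop))).integrableOn_compact hKc
        · rw [smul_eq_mul, mul_comm]
          refine mul_le_mul_of_nonneg_right (hA _ ⟨hs0, ?_⟩ _ ?_) (hf0 y hy)
          · linarith [hs.2, hτ'.2]
          · have h2 : ‖y‖ ≤ r := mem_closedBall_zero_iff.1 hy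
            have h3 := norm_sub_norm_le z y
            gcongr
            linarith
      have h2 := hu.nonneg z hz.1 s (ht.trans hs.1)
      linarith
    · intro z _ s hs
      exact IsSubAt.sub_const (IsSubAt.comp_add_const
        (isSubAt_heatPotential hKc hf z (by linarith [hs.1]))) _
    · exact fun z hz s hs => hu.super z hz s (ht.trans_lt hs.1)
  have hlim : Tendsto (fun τ => heatPotential K (fun y => u y t) x (h + τ) -
      ((A * ∫ y in K, u y t) + η)) (𝓝[>] (0 : ℝ)) (𝓝 (heatPotential K (fun y => u y t) x h -
      ((A * ∫ y in K, u y t) + η))) := by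
    refine Tendsto.sub_const ?_ _
    have h1 := (hasDerivAt_heatPotential_time hKc hf x hh).continuousAt
    refine h1.tendsto.comp ?_
    have h2 : Tendsto (fun τ : ℝ => h + τ) (𝓝 0) (𝓝 (h + 0)) :=
      Continuous.tendsto (by fun_prop) 0
    rw [add_zero] at h2
    exact h2.mono_left nhdsWithin_le_nhds
  have := le_of_tendsto hlim key
  linarith

theorem continuous_heatPotential_space {n : ℕ} {K : Set (Euc n)} (hK : IsCompact K)
    {f : Euc n → ℝ} (hf : ContinuousOn f K) {τ : ℝ} (hτ : 0 < τ) :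
    Continuous fun x => heatPotential K f x τ :=
  continuous_iff_continuousAt.2 fun x =>
    (heatPotential_space hK hf x hτ).1.1.self_of_nhds.continuousAt

theorem setIntegral_mul_heatPotential {n : ℕ} {K : Set (Euc n)} (hK : IsCompact K)
    {f g : Euc n → ℝ} (hf : ContinuousOn f K) (hg : ContinuousOn g K) (h : ℝ) :
    ∫ x in K, g x * heatPotential K f x h =
      ∫ y in K, f y * ∫ x in K, g x * heat n h (‖x - y‖ ^ 2) := by
  have hinteg : IntegrableOn (Function.uncurry fun x y => g x * (f y * heat n h (‖x - y‖ ^ 2)))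
      (K ×ˢ K) (volume.prod volume) := by
    refine ContinuousOn.integrableOn_compact (hK.prod hK) ?_
    have h1 : ContinuousOn (fun q : Euc n × Euc n => g q.1) (K ×ˢ K) :=
      hg.comp continuousOn_fst fun q hq => hq.1
    have h2 : ContinuousOn (fun q : Euc n × Euc n => f q.2) (K ×ˢ K) :=
      hf.comp continuousOn_snd fun q hq => hq.2
    exact h1.mul (h2.mul (Continuous.continuousOn (by fun_prop)))
  rw [IntegrableOn, ← Measure.prod_restrict] at hinteg
  have := integral_integral_swap hinteg
  simp only [integral_const_mul] at this
  simp only [heatPotential, smul_eq_mul]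
  rw [this]
  refine integral_congr_ae (Eventually.of_forall fun y => ?_)
  simp only [← integral_const_mul]
  refine integral_congr_ae (Eventually.of_forall fun x => ?_)
  ring

/-- The truncation `(Φ_σ - L)₊` of the heat kernel. -/
def truncHeat (n : ℕ) (L σ : ℝ) (x : Euc n) : ℝ :=
  max (heat n σ (‖x‖ ^ 2) - L) 0

@[fun_prop]
theorem continuous_truncHeat {n : ℕ} (L σ : ℝ) : Continuous (truncHeat n L σ) := by
  unfold truncHeat
  fun_prop

theorem truncHeat_nonneg {n : ℕ} (L σ : ℝ) (x : Euc n) : 0 ≤ truncHeat n L σ x :=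
  le_max_right _ _

theorem truncHeat_le {n : ℕ} {L σ : ℝ} (hL : 0 ≤ L) (hσ : 0 < σ) (x : Euc n) :
    truncHeat n L σ x ≤ heat n σ (‖x‖ ^ 2) :=
  max_le (by linarith) (heat_pos hσ _).le

theorem truncHeat_add_le {n : ℕ} {K : Set (Euc n)} (hK : MeasurableSet K) {L σ h : ℝ}
    (hσ : 0 < σ) (hh : 0 < h) (hsupp : ∀ x ∉ K, heat n σ (‖x‖ ^ 2) ≤ L) (y : Euc n) :
    truncHeat n L (h + σ) y ≤ ∫ x in K, truncHeat n L σ x * heat n h (‖x - y‖ ^ 2) := by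
  refine max_le ?_ (setIntegral_nonneg hK fun x _ =>
    mul_nonneg (truncHeat_nonneg _ _ _) (heat_pos hh _).le)
  obtain ⟨h1, h2⟩ := integral_heat_mul_heat hh hσ y
  have h3 := integrable_heat hh y
  have h4 : ∀ x, heat n h (‖x - y‖ ^ 2) * heat n σ (‖x‖ ^ 2) - L * heat n h (‖x - y‖ ^ 2) ≤
      truncHeat n L σ x * heat n h (‖x - y‖ ^ 2) := fun x => by
    have := heat_pos (n := n) hh (‖x - y‖ ^ 2)
    have h5 := le_max_left (heat n σ (‖x‖ ^ 2) - L) 0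
    unfold truncHeat
    nlinarith
  have h5 : ∀ x ∉ K, truncHeat n L σ x * heat n h (‖x - y‖ ^ 2) = 0 := fun x hx => by
    rw [truncHeat, max_eq_right (by linarith [hsupp x hx]), zero_mul]
  rw [setIntegral_eq_integral_of_forall_compl_eq_zero h5]
  calc heat n (h + σ) (‖y‖ ^ 2) - L
      = ∫ x, (heat n h (‖x - y‖ ^ 2) * heat n σ (‖x‖ ^ 2) - L * heat n h (‖x - y‖ ^ 2)) := by
        rw [integral_sub h1 (h3.const_mul L), h2, integral_const_mul, integral_heat hh, mul_one]
    _ ≤ _ := by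
        refine integral_mono (h1.sub (h3.const_mul L)) ?_ h4
        refine ((h1.add (h3.const_mul |L|))).mono' (Continuous.aestronglyMeasurable (by fun_prop))
          (Eventually.of_forall fun x => ?_)
        have h6 := heat_pos (n := n) hh (‖x - y‖ ^ 2)
        have h7 := heat_pos (n := n) hσ (‖x‖ ^ 2)
        rw [Real.norm_of_nonneg (mul_nonneg (truncHeat_nonneg _ _ _) h6.le)]
        have h8 : truncHeat n L σ x ≤ heat n σ (‖x‖ ^ 2) + |L| :=
          max_le (by linarith [neg_abs_le L]) (by positivity)
        simp only [Pi.add_apply]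
        nlinarith

theorem IsHeatSuper.setIntegral_mul_truncHeat_step {n : ℕ} {S : ℝ} {u : Euc n → ℝ → ℝ}
    (hu : IsHeatSuper n S u) {t h σ r A L : ℝ} (ht : 0 ≤ t) (hh : 0 < h) (hσ : 0 < σ)
    (hr : r ≤ 1) (hA : ∀ τ ∈ Ioc 0 (2 * h), ∀ ρ, (1 - r) ^ 2 ≤ ρ → heat n τ ρ ≤ A) (hL : 0 ≤ L)
    (hsupp : ∀ x ∉ closedBall (0 : Euc n) r, heat n σ (‖x‖ ^ 2) ≤ L) :
    ∫ y in closedBall 0 r, u y t * truncHeat n L (h + σ) y ≤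
      (∫ y in closedBall 0 r, u y (t + h) * truncHeat n L σ y) +
        A * (S * volume.real (closedBall (0 : Euc n) r)) := by
  have hstep := fun x hx => hu.heatPotential_le (x := x) ht hh (by linarith) hr hA hx
  set K := closedBall (0 : Euc n) r
  have hKc : IsCompact K := isCompact_closedBall 0 r
  have hK : K ⊆ closedBall 0 1 := closedBall_subset_closedBall hr
  have hf := hu.continuousOn_space ht hK
  have hf' := hu.continuousOn_space (by linarith : 0 ≤ t + h) hK
  have hA0 : 0 ≤ A := (heat_pos (n := n) (by linarith : 0 < 2 * h) _).le.trans
    (hA _ ⟨by linarith, le_rfl⟩ _ le_rfl)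
  have hI0 : 0 ≤ ∫ y in K, u y t :=
    setIntegral_nonneg hKc.measurableSet fun y hy => hu.nonneg y (hK hy) t ht
  have hI : ∫ y in K, u y t ≤ S * volume.real K := by
    have h1 := setIntegral_mono_on (hf.integrableOn_compact hKc)
      (integrableOn_const (hKc.measure_lt_top (μ := volume)).ne) hKc.measurableSet
      fun y hy => hu.le y (hK hy) t ht
    rwa [setIntegral_const, smul_eq_mul, mul_comm] at h1
  have hφ : Continuous (truncHeat n L σ) := continuous_truncHeat L σ
  have hφ1 : ∫ x in K, truncHeat n L σ x ≤ 1 := by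
    have h1 := integral_heat hσ (0 : Euc n)
    have h2 := integrable_heat hσ (0 : Euc n)
    simp only [sub_zero] at h1 h2
    rw [← h1]
    exact (setIntegral_mono_on (hφ.continuousOn.integrableOn_compact hKc) h2.integrableOn
      hKc.measurableSet fun x _ => truncHeat_le hL hσ x).trans
      (setIntegral_le_integral h2 (Eventually.of_forall fun x => (heat_pos hσ _).le))
  have hφ0 : 0 ≤ ∫ x in K, truncHeat n L σ x :=
    setIntegral_nonneg hKc.measurableSet fun x _ => truncHeat_nonneg _ _ _
  have hi1 : IntegrableOn (fun y => u y (t + h) * truncHeat n L σ y) K :=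
    (hf'.mul hφ.continuousOn).integrableOn_compact hKc
  have hi2 : IntegrableOn (fun y => (A * ∫ z in K, u z t) * truncHeat n L σ y) K :=
    (Continuous.continuousOn (by fun_prop)).integrableOn_compact hKc
  have hcp := continuous_heatPotential_space hKc hf hh
  have hcint : ContinuousOn (fun y => ∫ x in K, truncHeat n L σ x * heat n h (‖x - y‖ ^ 2)) K := by
    have := continuous_heatPotential_space hKc hφ.continuousOn hh
    simp only [heatPotential, smul_eq_mul] at this
    refine this.continuousOn.congr fun y _ => ?_
    exact integral_congr_ae (Eventually.of_forall fun x => by simp only [norm_sub_rev x y])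
  calc ∫ y in K, u y t * truncHeat n L (h + σ) y
      ≤ ∫ y in K, u y t * ∫ x in K, truncHeat n L σ x * heat n h (‖x - y‖ ^ 2) := by
        refine setIntegral_mono_on ?_ ?_ hKc.measurableSet fun y hy => ?_
        · exact (hf.mul (Continuous.continuousOn (by fun_prop))).integrableOn_compact hKc
        · exact (hf.mul hcint).integrableOn_compact hKc
        · exact mul_le_mul_of_nonneg_left
            (truncHeat_add_le hKc.measurableSet hσ hh hsupp y) (hu.nonneg y (hK hy) t ht)
    _ = ∫ x in K, truncHeat n L σ x * heatPotential K (fun y => u y t) x h :=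
        (setIntegral_mul_heatPotential hKc hf hφ.continuousOn h).symm
    _ ≤ ∫ x in K, (u x (t + h) * truncHeat n L σ x +
          (A * ∫ z in K, u z t) * truncHeat n L σ x) := by
        refine setIntegral_mono_on ?_ (hi1.add hi2) hKc.measurableSet fun x hx => ?_
        · exact (Continuous.continuousOn (by fun_prop)).integrableOn_compact hKc
        · have h1 := hstep x (hK hx)
          have h2 := truncHeat_nonneg (n := n) L σ x
          nlinarith
    _ = (∫ x in K, u x (t + h) * truncHeat n L σ x) +
          A * ((∫ z in K, u z t) * ∫ x in K, truncHeat n L σ x) := by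
        rw [integral_add hi1 hi2, integral_const_mul, mul_assoc]
    _ ≤ _ := by
        have h1 : (∫ z in K, u z t) * ∫ x in K, truncHeat n L σ x ≤ S * volume.real K := by
          nlinarith
        exact add_le_add le_rfl (mul_le_mul_of_nonneg_left h1 hA0)

theorem IsHeatSuper.setIntegral_mul_truncHeat_le {n : ℕ} {S : ℝ} {u : Euc n → ℝ → ℝ}
    (hu : IsHeatSuper n S u) {t σ T r L : ℝ} (ht : 0 ≤ t) (hσ : 0 < σ) (hσT : σ < T)
    (hr : r < 1) (hL : 0 ≤ L)
    (hsupp : ∀ s ∈ Icc σ T, ∀ x ∉ closedBall (0 : Euc n) r, heat n s (‖x‖ ^ 2) ≤ L) :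
    ∫ y in closedBall 0 r, u y t * truncHeat n L T y ≤
      ∫ y in closedBall 0 r, u y (t + (T - σ)) * truncHeat n L σ y := by
  obtain ⟨C, hC0, hC⟩ := exists_heat_le_sq (n := n) (δ := (1 - r) ^ 2)
    (pow_pos (by linarith) 2)
  have hV : 0 ≤ S * volume.real (closedBall (0 : Euc n) r) :=
    mul_nonneg hu.bound_nonneg measureReal_nonneg
  set V := S * volume.real (closedBall (0 : Euc n) r)
  have hind : ∀ h, 0 < h → 2 * h ≤ 1 → ∀ k : ℕ, σ + k * h ≤ T → ∀ t, 0 ≤ t →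
      ∫ y in closedBall 0 r, u y t * truncHeat n L (σ + k * h) y ≤
      (∫ y in closedBall 0 r, u y (t + k * h) * truncHeat n L σ y) +
        k * (C * (2 * h) ^ 2 * V) := by
    intro h hh hh1 k
    induction k with
    | zero => intro _ t _; simp
    | succ k ih =>
      intro hk t ht
      push_cast at hk ⊢
      have hkh : 0 ≤ k * h := by positivity
      have h1 := hu.setIntegral_mul_truncHeat_step (A := C * (2 * h) ^ 2) (L := L) (r := r) ht hh
        (by linarith : 0 < σ + k * h) hr.le (fun τ hτ ρ hρ => ?_) hL
        (hsupp _ ⟨by linarith, by linarith⟩)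
      · have h2 := ih (by linarith) (t + h) (by linarith)
        rw [show σ + (k + 1) * h = h + (σ + k * h) by ring,
          show t + (k + 1) * h = t + h + k * h by ring]
        linarith
      · refine (hC τ ⟨hτ.1, hτ.2.trans hh1⟩ ρ hρ).trans ?_
        have := hτ.1
        gcongr
        exact hτ.2
  have hlim : Tendsto (fun N : ℕ => (∫ y in closedBall 0 r, u y (t + (T - σ)) * truncHeat n L σ y) +
      4 * C * (T - σ) ^ 2 * V / N) atTop
      (𝓝 ((∫ y in closedBall 0 r, u y (t + (T - σ)) * truncHeat n L σ y) + 0)) :=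
    tendsto_const_nhds.add (tendsto_const_div_atTop_nhds_zero_nat _)
  rw [add_zero] at hlim
  refine ge_of_tendsto hlim ?_
  filter_upwards [eventually_ge_atTop (⌈2 * (T - σ)⌉₊), eventually_gt_atTop 0] with N hN hN0
  have hN0' : (0 : ℝ) < N := by exact_mod_cast hN0
  have hN' : 2 * (T - σ) ≤ N := (Nat.le_ceil _).trans (by exact_mod_cast hN)
  have hTσ : 0 < T - σ := by linarith
  have hNh : N * ((T - σ) / N) = T - σ := by field_simp
  have := hind ((T - σ) / N) (by positivity) (by rw [← mul_div_assoc, div_le_one hN0']; exact hN')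
    N (by rw [hNh]; linarith) t ht
  rw [hNh, show σ + (T - σ) = T by ring] at this
  refine this.trans (le_of_eq ?_)
  congr 1
  field_simp
  ring

theorem heat_sub_heat_ge {n : ℕ} {σ : ℝ} (hσ : 0 < σ) (ρ ρ' : ℝ) :
    heat n σ ρ' * ((ρ' - ρ) / (4 * σ)) ≤ heat n σ ρ - heat n σ ρ' := by
  have h1 : heat n σ ρ = heat n σ ρ' * Real.exp ((ρ' - ρ) / (4 * σ)) := by
    unfold heat
    rw [mul_assoc ((4 * Real.pi * σ) ^ (-(n : ℝ) / 2)), ← Real.exp_add]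
    ring_nf
  have h2 := Real.add_one_le_exp ((ρ' - ρ) / (4 * σ))
  have h3 := heat_pos (n := n) hσ ρ'
  rw [h1]
  nlinarith

theorem isSubAt_heat {n : ℕ} (b : ℝ) (x : Euc n) {τ : ℝ} (hτ : 0 < τ) :
    IsSubAt (fun _ => 0) (fun x τ => b * heat n τ (‖x‖ ^ 2)) x τ := by
  have h1 : ∀ ρ, HasDerivAt (fun ρ => b * heat n τ ρ) (b * (-(1 / (4 * τ)) * heat n τ ρ)) ρ :=
    fun ρ => (hasDerivAt_heat_sq_dist τ ρ).const_mul b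
  have h2 : ∀ ρ, HasDerivAt (fun ρ => b * (-(1 / (4 * τ)) * heat n τ ρ))
      (b * (-(1 / (4 * τ)) * (-(1 / (4 * τ)) * heat n τ ρ))) ρ :=
    fun ρ => ((hasDerivAt_heat_sq_dist τ ρ).const_mul _).const_mul b
  obtain ⟨h3, h4, -⟩ := radial_jet (n := n) (c := 0) (x := x) (Eventually.of_forall h1) (h2 _)
  simp only [sub_zero] at h3 h4
  refine ⟨h3, _, (hasDerivAt_heat_time hτ (‖x‖ ^ 2)).const_mul b, ?_⟩
  rw [h4]
  refine le_of_eq ?_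
  field_simp
  ring

theorem heat_le_of_notMem_closedBall {n : ℕ} {T r s : ℝ} (hr : 0 ≤ r) (hs : 0 < s) (hsT : s ≤ T)
    (hT : 2 * n * T ≤ r ^ 2) {x : Euc n} (hx : x ∉ closedBall (0 : Euc n) r) :
    heat n s (‖x‖ ^ 2) ≤ heat n T (r ^ 2) := by
  have h1 : r < ‖x‖ := by simpa using hx
  exact (heat_antitone hs (by gcongr)).trans (heat_mono_time hs hsT hT)

/-- The mass of the initial data weighted by the distance to the boundary controls the mass in the
core of the ball at a later time. -/
theorem IsHeatSuper.core_mass_ge {n : ℕ} {S : ℝ} {u : Euc n → ℝ → ℝ}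
    (hu : IsHeatSuper n S u) {σ T : ℝ} (hσ : 0 < σ) (hσT : σ < T) (hT : 2 * n * T ≤ 1 / 4)
    (hcore : heat n σ (1 / 16) ≤ heat n T 1) :
    (heat n T 1 / (4 * T)) * ∫ x in ball (0 : Euc n) 1, u x 0 * (1 - ‖x‖) ≤
      heat n σ 0 * ∫ x in closedBall (0 : Euc n) (1 / 4), u x (T - σ) := by
  have hT0 : 0 < T := hσ.trans hσT
  have hB : IsCompact (closedBall (0 : Euc n) 1) := isCompact_closedBall 0 1
  have hu0 := hu.continuousOn_space le_rfl (Subset.rfl (s := closedBall (0 : Euc n) 1))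
  have hu1 := hu.continuousOn_space (by linarith : 0 ≤ T - σ)
    (Subset.rfl (s := closedBall (0 : Euc n) 1))
  have key : ∀ r, 1 / 2 ≤ r → r < 1 →
      (∫ x in closedBall (0 : Euc n) 1, u x 0 * truncHeat n (heat n T 1) T x) -
        (heat n T (r ^ 2) - heat n T 1) * (∫ x in closedBall (0 : Euc n) 1, u x 0) ≤
      heat n σ 0 * ∫ x in closedBall (0 : Euc n) (1 / 4), u x (T - σ) := by
    intro r hr hr1
    have hrT : 2 * n * T ≤ r ^ 2 := by nlinarith
    have hsub : closedBall (0 : Euc n) r ⊆ closedBall 0 1 := closedBall_subset_closedBall hr1.le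
    have hchain := hu.setIntegral_mul_truncHeat_le (t := 0) le_rfl hσ hσT hr1 (heat_pos hT0 (r ^ 2)).le
      fun s hs x hx => heat_le_of_notMem_closedBall (by linarith) (hσ.trans_le hs.1) hs.2 hrT hx
    rw [zero_add] at hchain
    have hL : heat n T 1 ≤ heat n T (r ^ 2) := heat_antitone hT0 (by nlinarith)
    have hleft : (∫ x in closedBall (0 : Euc n) 1, u x 0 * truncHeat n (heat n T 1) T x) -
        (heat n T (r ^ 2) - heat n T 1) * (∫ x in closedBall (0 : Euc n) 1, u x 0) ≤
        ∫ y in closedBall 0 r, u y 0 * truncHeat n (heat n T (r ^ 2)) T y := by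
      have h1 : ∫ y in closedBall 0 r, u y 0 * truncHeat n (heat n T (r ^ 2)) T y =
          ∫ y in closedBall 0 1, u y 0 * truncHeat n (heat n T (r ^ 2)) T y := by
        refine (setIntegral_eq_of_subset_of_forall_sdiff_eq_zero hB.measurableSet hsub
          fun y hy => ?_).symm
        have := heat_le_of_notMem_closedBall (by linarith) hT0 le_rfl hrT hy.2
        rw [truncHeat, max_eq_right (by linarith), mul_zero]
      have hi1 : IntegrableOn (fun x => u x 0 * truncHeat n (heat n T 1) T x)
          (closedBall (0 : Euc n) 1) :=
        (hu0.mul (Continuous.continuousOn (by fun_prop))).integrableOn_compact hB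
      have hi2 : IntegrableOn (fun x => (heat n T (r ^ 2) - heat n T 1) * u x 0)
          (closedBall (0 : Euc n) 1) := (hu0.integrableOn_compact hB).const_mul _
      rw [h1, ← integral_const_mul, ← integral_sub hi1 hi2]
      refine setIntegral_mono_on (hi1.sub hi2) ?_ hB.measurableSet fun y hy => ?_
      · exact (hu0.mul (Continuous.continuousOn (by fun_prop))).integrableOn_compact hB
      · have h2 := hu.nonneg y hy 0 le_rfl
        have h3 : truncHeat n (heat n T 1) T y - (heat n T (r ^ 2) - heat n T 1) ≤
            truncHeat n (heat n T (r ^ 2)) T y := by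
          unfold truncHeat
          rw [sub_le_iff_le_add]
          refine max_le ?_ (add_nonneg (le_max_right _ _) (by linarith))
          linarith [le_max_left (heat n T (‖y‖ ^ 2) - heat n T (r ^ 2)) 0]
        nlinarith
    have hright : ∫ y in closedBall 0 r, u y (T - σ) * truncHeat n (heat n T (r ^ 2)) σ y ≤
        heat n σ 0 * ∫ x in closedBall (0 : Euc n) (1 / 4), u x (T - σ) := by
      have hsub' : closedBall (0 : Euc n) (1 / 4) ⊆ closedBall 0 r :=
        closedBall_subset_closedBall (by linarith)
      have h1 := setIntegral_eq_of_subset_of_forall_sdiff_eq_zero (μ := volume)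
        (f := fun y => u y (T - σ) * truncHeat n (heat n T (r ^ 2)) σ y)
        (isCompact_closedBall (0 : Euc n) r).measurableSet hsub' fun y hy => by
          have h2 : 1 / 4 < ‖y‖ := by simpa using hy.2
          have h3 : heat n σ (‖y‖ ^ 2) ≤ heat n σ (1 / 16) := heat_antitone hσ (by nlinarith)
          simp only [truncHeat]
          rw [max_eq_right (by linarith), mul_zero]
      rw [h1, ← integral_const_mul]
      have hc := hu1.mono (hsub'.trans hsub)
      have hK : IsCompact (closedBall (0 : Euc n) (1 / 4)) := isCompact_closedBall 0 _
      refine setIntegral_mono_on ?_ ((hc.integrableOn_compact hK).const_mul _)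
        hK.measurableSet fun y hy => ?_
      · exact (hc.mul (Continuous.continuousOn (by fun_prop))).integrableOn_compact hK
      · rw [mul_comm]
        refine mul_le_mul_of_nonneg_right ?_ (hu.nonneg y (hsub (hsub' hy)) _ (by linarith))
        exact (truncHeat_le (heat_pos hT0 _).le hσ y).trans (heat_antitone hσ (by positivity))
    linarith
  have hlim : Tendsto (fun r : ℝ =>
      (∫ x in closedBall (0 : Euc n) 1, u x 0 * truncHeat n (heat n T 1) T x) -
        (heat n T (r ^ 2) - heat n T 1) * (∫ x in closedBall (0 : Euc n) 1, u x 0)) (𝓝[<] 1)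
      (𝓝 (∫ x in closedBall (0 : Euc n) 1, u x 0 * truncHeat n (heat n T 1) T x)) := by
    have : Tendsto (fun r : ℝ =>
      (∫ x in closedBall (0 : Euc n) 1, u x 0 * truncHeat n (heat n T 1) T x) -
        (heat n T (r ^ 2) - heat n T 1) * (∫ x in closedBall (0 : Euc n) 1, u x 0)) (𝓝 1)
      (𝓝 ((∫ x in closedBall (0 : Euc n) 1, u x 0 * truncHeat n (heat n T 1) T x) -
        (heat n T (1 ^ 2) - heat n T 1) * (∫ x in closedBall (0 : Euc n) 1, u x 0))) :=
      Continuous.tendsto (by fun_prop) 1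
    rw [one_pow, sub_self, zero_mul, sub_zero] at this
    exact this.mono_left nhdsWithin_le_nhds
  have hmain := le_of_tendsto hlim (by
    filter_upwards [Ico_mem_nhdsLT (show (1 / 2 : ℝ) < 1 by norm_num)] with r hr
      using key r hr.1 hr.2)
  refine le_trans ?_ hmain
  rw [← integral_const_mul]
  have hi3 : IntegrableOn (fun x => u x 0 * truncHeat n (heat n T 1) T x)
      (closedBall (0 : Euc n) 1) :=
    (hu0.mul (Continuous.continuousOn (by fun_prop))).integrableOn_compact hB
  have hi4 : IntegrableOn (fun x => heat n T 1 / (4 * T) * (u x 0 * (1 - ‖x‖)))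
      (closedBall (0 : Euc n) 1) :=
    (ContinuousOn.mul continuousOn_const
      (hu0.mul (Continuous.continuousOn (by fun_prop)))).integrableOn_compact hB
  have hpt : ∀ x ∈ closedBall (0 : Euc n) 1, heat n T 1 / (4 * T) * (u x 0 * (1 - ‖x‖)) ≤
      u x 0 * truncHeat n (heat n T 1) T x := fun x hx => by
    have h1 := hu.nonneg x hx 0 le_rfl
    have hx1 : ‖x‖ ≤ 1 := by simpa using hx
    have h2 : heat n T 1 / (4 * T) * (1 - ‖x‖) ≤ truncHeat n (heat n T 1) T x := by
      refine le_trans ?_ (le_max_left _ _)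
      refine le_trans ?_ (heat_sub_heat_ge hT0 _ _)
      have h3 := heat_pos (n := n) hT0 1
      rw [mul_div_assoc', div_mul_eq_mul_div]
      gcongr
      nlinarith [norm_nonneg x]
    nlinarith
  calc ∫ x in ball (0 : Euc n) 1, heat n T 1 / (4 * T) * (u x 0 * (1 - ‖x‖))
      ≤ ∫ x in closedBall (0 : Euc n) 1, heat n T 1 / (4 * T) * (u x 0 * (1 - ‖x‖)) := by
        refine setIntegral_mono_set hi4 ?_ (LE.le.eventuallyLE ball_subset_closedBall)
        refine (ae_restrict_iff' hB.measurableSet).2 (Eventually.of_forall fun x hx => ?_)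
        have hx1 : ‖x‖ ≤ 1 := by simpa using hx
        exact mul_nonneg (div_nonneg (heat_pos hT0 _).le (by positivity))
          (mul_nonneg (hu.nonneg x hx 0 le_rfl) (by linarith))
    _ ≤ _ := setIntegral_mono_on hi4 hi3 hB.measurableSet hpt

theorem exists_heat_le {n : ℕ} {δ η T : ℝ} (hδ : 0 < δ) (hη : 0 < η) (hT : 0 < T) :
    ∃ σ, 0 < σ ∧ σ < T ∧ heat n σ δ ≤ η := by
  obtain ⟨C, hC, h⟩ := exists_heat_le_sq (n := n) hδ
  have hlim : Tendsto (fun τ : ℝ => C * τ ^ 2) (𝓝[>] 0) (𝓝 0) := by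
    have : Tendsto (fun τ : ℝ => C * τ ^ 2) (𝓝 0) (𝓝 (C * 0 ^ 2)) :=
      Continuous.tendsto (by fun_prop) 0
    rw [zero_pow two_ne_zero, mul_zero] at this
    exact this.mono_left nhdsWithin_le_nhds
  obtain ⟨σ, h1, h2, h3⟩ := ((hlim.eventually (ge_mem_nhds hη)).and
    ((show ∀ᶠ τ in 𝓝[>] (0 : ℝ), τ ∈ Ioo 0 T from Ioo_mem_nhdsGT hT).and
      (show ∀ᶠ τ in 𝓝[>] (0 : ℝ), τ ∈ Ioo 0 1 from Ioo_mem_nhdsGT one_pos))).exists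
  exact ⟨σ, h2.1, h2.2, (h σ ⟨h3.1, h3.2.le⟩ δ le_rfl).trans h1⟩

theorem exists_heat_lt {n : ℕ} {T ρ ρ' : ℝ} (hT : 0 < T) (hρ : ρ < ρ') (hρ' : 2 * n * T < ρ') :
    ∃ T', T < T' ∧ 2 * n * T' ≤ ρ' ∧ heat n T' ρ' < heat n T ρ := by
  have h1 : heat n T ρ' < heat n T ρ := by
    have h2 := heat_sub_heat_ge (n := n) hT ρ ρ'
    have h3 : 0 < heat n T ρ' * ((ρ' - ρ) / (4 * T)) :=
      mul_pos (heat_pos hT _) (div_pos (by linarith) (by positivity))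
    linarith
  have h2 : ∀ᶠ T' in 𝓝 T, heat n T' ρ' < heat n T ρ :=
    (hasDerivAt_heat_time hT ρ').continuousAt.eventually (gt_mem_nhds h1)
  have h3 : ∀ᶠ T' : ℝ in 𝓝 T, 2 * n * T' < ρ' :=
    (Continuous.tendsto (by fun_prop : Continuous fun T' : ℝ => 2 * n * T') T).eventually
      (gt_mem_nhds hρ')
  obtain ⟨T', ⟨h4, h5⟩, h6⟩ := (((h2.and h3).filter_mono nhdsWithin_le_nhds).and
    (self_mem_nhdsWithin (s := Ioi T))).exists
  exact ⟨T', h6, h5.le, h4⟩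

/-- A lower bound in the core of the ball propagates to a lower bound vanishing linearly at the
boundary. -/
theorem IsHeatSuper.propagate {n : ℕ} {S : ℝ} {u : Euc n → ℝ → ℝ}
    (hu : IsHeatSuper n S u) {σ T b t : ℝ} (hσ : 0 < σ) (hσT : σ ≤ T) (hT : 2 * n * T ≤ 1)
    (hcore : heat n σ (1 / 16) ≤ heat n T 1) (hb : 0 ≤ b) (ht : 0 ≤ t)
    (hut : ∀ x ∈ closedBall (0 : Euc n) (1 / 4), b * heat n σ 0 ≤ u x t)
    {x : Euc n} (hx : x ∈ closedBall (0 : Euc n) 1) :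
    b * (heat n T 1 / (4 * T)) * (1 - ‖x‖ ^ 2) ≤ u x (t + (T - σ)) := by
  have hT0 : 0 < T := hσ.trans_le hσT
  have hcmp := parabolic_comparison (F := fun _ : Euc n => 0) (isCompact_closedBall (0 : Euc n) 1)
    isOpen_ball ball_subset_closedBall (a := t) (b := t + (T - σ)) (u := u)
    (v := fun x s => b * heat n (s + (σ - t)) (‖x‖ ^ 2) - b * heat n T 1) ?_ ?_ ?_ ?_ ?_ ?_
    x hx (t + (T - σ)) ⟨by linarith, le_rfl⟩
  · have h1 := heat_sub_heat_ge (n := n) hT0 (‖x‖ ^ 2) 1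
    rw [show t + (T - σ) + (σ - t) = T by ring, ← mul_sub] at hcmp
    refine le_trans ?_ hcmp
    rw [mul_assoc]
    refine mul_le_mul_of_nonneg_left (le_trans (le_of_eq ?_) h1) hb
    ring
  · refine ContinuousOn.sub (continuousOn_const.mul ?_) continuousOn_const
    exact continuousOn_heat.comp (f := fun q : Euc n × ℝ => (q.2 + (σ - t), ‖q.1‖ ^ 2))
      (by fun_prop) fun q hq => ⟨by have := hq.2.1; simp only [mem_Ioi]; linarith, mem_univ _⟩
  · exact hu.cont.mono (prod_mono Subset.rfl fun s hs => ht.trans hs.1)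
  · intro y hy
    rw [show t + (σ - t) = σ by ring, ← mul_sub]
    by_cases hy' : ‖y‖ ≤ 1 / 4
    · refine le_trans (mul_le_mul_of_nonneg_left ?_ hb) (hut y (by simpa using hy'))
      linarith [heat_pos (n := n) hT0 1, heat_antitone (n := n) hσ (sq_nonneg ‖y‖)]
    · have h1 : heat n σ (‖y‖ ^ 2) ≤ heat n σ (1 / 16) := heat_antitone hσ (by nlinarith)
      refine le_trans (mul_nonpos_of_nonneg_of_nonpos hb (by linarith)) (hu.nonneg y hy t ht)
  · intro y hy s hs
    have hy1 : ‖y‖ = 1 := by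
      have h1 : ‖y‖ ≤ 1 := mem_closedBall_zero_iff.1 hy.1
      have h2 : ¬ ‖y‖ < 1 := fun h => hy.2 (mem_ball_zero_iff.2 h)
      linarith
    rw [hy1, one_pow, ← mul_sub]
    have h1 : heat n (s + (σ - t)) 1 ≤ heat n T 1 :=
      heat_mono_time (by linarith [hs.1]) (by linarith [hs.2]) hT
    exact le_trans (mul_nonpos_of_nonneg_of_nonpos hb (by linarith))
      (hu.nonneg y hy.1 s (ht.trans hs.1))
  · intro y _ s hs
    exact ((isSubAt_heat b y (τ := s + (σ - t)) (by linarith [hs.1])).comp_add_const).sub_const _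
  · exact fun y hy s hs => hu.super y hy s (ht.trans_lt hs.1)

/-- At a universal time, a nonnegative supersolution of the heat equation is bounded below by a
universal multiple of the weighted mass of its initial data times the distance to the boundary. -/
theorem exists_weighted_mass_le {n : ℕ} (hn : 1 ≤ n) :
    ∃ c > 0, ∃ t > 0, ∀ (S : ℝ) (u : Euc n → ℝ → ℝ), IsHeatSuper n S u →
      ∀ x ∈ closedBall (0 : Euc n) 1,
        c * (∫ y in ball (0 : Euc n) 1, u y 0 * (1 - ‖y‖)) * (1 - ‖x‖ ^ 2) ≤ u x t := by
  have hn' : (0 : ℝ) < n := by exact_mod_cast hn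
  set T : ℝ := 1 / (8 * n) with hTdef
  have hT0 : 0 < T := by positivity
  have hT : 2 * n * T = 1 / 4 := by rw [hTdef]; field_simp; norm_num
  obtain ⟨σ, hσ, hσT, hcore⟩ := exists_heat_le (n := n) (δ := 1 / 16) (by norm_num)
    (heat_pos (n := n) hT0 1) hT0
  obtain ⟨T', hTT', hT', hlt⟩ := exists_heat_lt (n := n) (ρ := 1 / 4) (ρ' := 9 / 16) hT0
    (by norm_num) (by rw [hT]; norm_num)
  set δ := heat n T (1 / 4) - heat n T' (9 / 16) with hδ
  have hδ0 : 0 < δ := by linarith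
  have hP : 0 < heat n σ 0 := heat_pos hσ 0
  have hQ : 0 < heat n T 1 := heat_pos hT0 1
  set a := heat n T 1 / (4 * T) with ha
  have ha0 : 0 < a := by positivity
  refine ⟨δ * a ^ 2 / heat n σ 0 ^ 2, by positivity, T - σ + T + (T - σ), by linarith,
    fun S u hu x hx => ?_⟩
  have hmass := hu.core_mass_ge hσ hσT hT.le hcore
  set I := ∫ y in ball (0 : Euc n) 1, u y 0 * (1 - ‖y‖)
  set m := ∫ y in closedBall (0 : Euc n) (1 / 4), u y (T - σ) with hm
  have hK : closedBall (0 : Euc n) (1 / 4) ⊆ closedBall 0 1 :=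
    closedBall_subset_closedBall (by norm_num)
  have hKc : IsCompact (closedBall (0 : Euc n) (1 / 4)) := isCompact_closedBall 0 _
  have ht1 : 0 ≤ T - σ := by linarith
  have hm0 : 0 ≤ m := setIntegral_nonneg hKc.measurableSet fun y hy => hu.nonneg y (hK hy) _ ht1
  have hcont := hu.continuousOn_space ht1 hK
  have hstep : ∀ y ∈ closedBall (0 : Euc n) (1 / 4),
      δ * m / heat n σ 0 * heat n σ 0 ≤ u y (T - σ + T) := by
    intro y hy
    have h1 := hu.heatPotential_le (t := T - σ) (h := T) (h' := T') (r := 1 / 4)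
      (A := heat n T' (9 / 16)) ht1 hT0 hTT' (by norm_num) (fun τ hτ ρ hρ =>
        (heat_antitone hτ.1 (show (9 / 16 : ℝ) ≤ ρ by linarith)).trans
          (heat_mono_time hτ.1 hτ.2 hT')) (hK hy)
    have h2 : heat n T (1 / 4) * m ≤
        heatPotential (closedBall (0 : Euc n) (1 / 4)) (fun z => u z (T - σ)) y T := by
      rw [hm, ← integral_const_mul]
      refine setIntegral_mono_on ((hcont.integrableOn_compact hKc).const_mul _) ?_
        hKc.measurableSet fun z hz => ?_
      · exact (hcont.smul (((continuous_heat T).comp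
          (g := heat n T) (f := fun z : Euc n => ‖y - z‖ ^ 2)
          (by fun_prop)).continuousOn)).integrableOn_compact hKc
      · have h3 : ‖y - z‖ ≤ 1 / 2 := by
          have h4 := norm_sub_le y z
          have h5 := mem_closedBall_zero_iff.1 hy
          have h6 := mem_closedBall_zero_iff.1 hz
          linarith
        rw [smul_eq_mul, mul_comm]
        refine mul_le_mul_of_nonneg_left (heat_antitone hT0 ?_) (hu.nonneg z (hK hz) _ ht1)
        nlinarith [norm_nonneg (y - z)]
    rw [div_mul_cancel₀ _ hP.ne', hδ, sub_mul]
    linarith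
  have hprop := hu.propagate hσ hσT.le (by linarith) hcore (by positivity)
    (by linarith : 0 ≤ T - σ + T) hstep hx
  refine le_trans ?_ hprop
  have hx1 : ‖x‖ ≤ 1 := mem_closedBall_zero_iff.1 hx
  refine mul_le_mul_of_nonneg_right ?_ (by nlinarith [norm_nonneg x])
  calc δ * a ^ 2 / heat n σ 0 ^ 2 * I = δ * a / heat n σ 0 ^ 2 * (a * I) := by ring
    _ ≤ δ * a / heat n σ 0 ^ 2 * (heat n σ 0 * m) := by gcongr
    _ = δ * m / heat n σ 0 * a := by field_simp

theorem Fj_nonneg (n : ℕ) (p : ℝ) (j : ℕ) (ξ : Euc n) : 0 ≤ Fj n p j ξ := by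
  unfold Fj
  positivity

theorem Fj_zero (n : ℕ) {p : ℝ} (hp : 0 < p) (j : ℕ) : Fj n p j 0 = 0 := by
  simp [Fj, Real.zero_rpow hp.ne']

theorem IsRegSol.hasDerivAt_time {n : ℕ} {p : ℝ} {Ω : Set (Euc n)} {j : ℕ} {u0 : Euc n → ℝ}
    {u : Euc n → ℝ → ℝ} (h : IsRegSol n p Ω j u0 u) {x : Euc n} (hx : x ∈ Ω) {t : ℝ} (ht : 0 < t) :
    HasDerivAt (u x)
      (lap n (fun y => u y t) x + Fj n p j (gradient (fun y => u y t) x)) t := by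
  rw [← h.eqn x hx t ht]
  exact (((h.time_reg x hx).contDiffAt (Ioi_mem_nhds ht)).differentiableAt one_ne_zero).hasDerivAt

theorem IsRegSol.twiceDiffAt {n : ℕ} {p : ℝ} {Ω : Set (Euc n)} (hΩ : IsOpen Ω) {j : ℕ}
    {u0 : Euc n → ℝ} {u : Euc n → ℝ → ℝ} (h : IsRegSol n p Ω j u0 u) {x : Euc n} (hx : x ∈ Ω)
    {t : ℝ} (ht : 0 < t) : TwiceDiffAt (fun y => u y t) x :=
  .of_contDiffAt ((h.space_reg t ht).contDiffAt (hΩ.mem_nhds hx))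

theorem IsRegSol.isSubAt {n : ℕ} {p : ℝ} {Ω : Set (Euc n)} (hΩ : IsOpen Ω) {j : ℕ}
    {u0 : Euc n → ℝ} {u : Euc n → ℝ → ℝ} (h : IsRegSol n p Ω j u0 u) {x : Euc n} (hx : x ∈ Ω)
    {t : ℝ} (ht : 0 < t) : IsSubAt (Fj n p j) u x t :=
  ⟨h.twiceDiffAt hΩ hx ht, _, h.hasDerivAt_time hx ht, le_rfl⟩

theorem IsRegSol.isSuperAt {n : ℕ} {p : ℝ} {Ω : Set (Euc n)} (hΩ : IsOpen Ω) {j : ℕ}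
    {u0 : Euc n → ℝ} {u : Euc n → ℝ → ℝ} (h : IsRegSol n p Ω j u0 u) {x : Euc n} (hx : x ∈ Ω)
    {t : ℝ} (ht : 0 < t) : IsSuperAt (Fj n p j) u x t :=
  ⟨h.twiceDiffAt hΩ hx ht, _, h.hasDerivAt_time hx ht, le_rfl⟩

theorem isSuperAt_const {n : ℕ} {F : Euc n → ℝ} (hF : F 0 = 0) (S : ℝ) (x : Euc n) (t : ℝ) :
    IsSuperAt F (fun _ _ => S) x t := by
  refine ⟨.of_contDiffAt contDiffAt_const, 0, hasDerivAt_const _ _, ?_⟩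
  have h1 : gradient (fun _ : Euc n => S) x = 0 := by simp [gradient]
  rw [h1, hF]
  simp [lap]

theorem IsRegSol.le_of_le {n : ℕ} {p : ℝ} (hp : 0 < p) {j : ℕ} {u0 : Euc n → ℝ}
    {u : Euc n → ℝ → ℝ} (h : IsRegSol n p (ball 0 1) j u0 u) {S : ℝ} (hS : 0 ≤ S)
    (hu0 : ∀ x ∈ closedBall (0 : Euc n) 1, u0 x ≤ S) {x : Euc n}
    (hx : x ∈ closedBall (0 : Euc n) 1) {t : ℝ} (ht : 0 ≤ t) : u x t ≤ S := by
  have hcl : closure (ball (0 : Euc n) 1) = closedBall 0 1 := closure_ball 0 one_ne_zero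
  refine parabolic_comparison (F := Fj n p j) (isCompact_closedBall (0 : Euc n) 1) isOpen_ball
    ball_subset_closedBall (a := 0) (b := t) (v := u) (u := fun _ _ => S) ?_ continuousOn_const
    (fun y hy => ?_) (fun y hy s hs => ?_) (fun y hy s hs => h.isSubAt isOpen_ball hy hs.1)
    (fun y hy s hs => isSuperAt_const (Fj_zero n hp j) _ _ _) x hx t ⟨ht, le_rfl⟩
  · exact h.cont.mono (prod_mono (hcl ▸ Subset.rfl) fun s hs => hs.1)
  · rw [h.ic y (hcl ▸ hy)]
    exact hu0 y hy
  · rcases hs.1.eq_or_lt with h0 | h0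
    · rw [← h0, h.ic y (hcl ▸ hy.1)]
      exact hu0 y hy.1
    · rw [h.bc y ?_ s h0]
      · exact hS
      · rw [frontier, hcl, isOpen_ball.interior_eq]
        exact hy

theorem IsRegSol.isHeatSuper {n : ℕ} {p : ℝ} (hp : 0 < p) {j : ℕ} {u0 : Euc n → ℝ}
    {u : Euc n → ℝ → ℝ} (h : IsRegSol n p (ball 0 1) j u0 u) {S : ℝ} (hS : 0 ≤ S)
    (hu0 : ∀ x ∈ closedBall (0 : Euc n) 1, u0 x ≤ S) : IsHeatSuper n S u := by
  have hcl : closure (ball (0 : Euc n) 1) = closedBall 0 1 := closure_ball 0 one_ne_zero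
  refine ⟨hcl ▸ h.cont, fun x hx t ht => h.nonneg x (hcl ▸ hx) t ht,
    fun x hx t ht => h.le_of_le hp hS hu0 hx ht, fun x hx t ht => ?_⟩
  obtain ⟨h1, d, h2, h3⟩ := h.isSuperAt isOpen_ball hx ht
  exact ⟨h1, d, h2, by linarith [Fj_nonneg n p j (gradient (fun y => u y t) x)]⟩

/-- Once a regularized solution lies above a large multiple of `1 - |x|²`, it does so for two
more units of time, with an exponentially decaying constant. -/
theorem IsRegSol.maintain {n : ℕ} {p : ℝ} (hp : 2 < p) {j : ℕ} (hj : 1 ≤ j) {u0 : Euc n → ℝ}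
    {u : Euc n → ℝ → ℝ} (h : IsRegSol n p (ball 0 1) j u0 u) {m t : ℝ} (ht : 0 ≤ t)
    (hm : 2 * n ≤ m * Real.exp (-8 * n)) (hm1 : 1 ≤ m * Real.exp (-8 * n))
    (hut : ∀ x ∈ closedBall (0 : Euc n) 1, m * (1 - ‖x‖ ^ 2) ≤ u x t) {x : Euc n}
    (hx : x ∈ closedBall (0 : Euc n) 1) {τ : ℝ} (hτ : τ ∈ Icc (0 : ℝ) 2) :
    m * Real.exp (-4 * n * τ) * (1 - ‖x‖ ^ 2) ≤ u x (t + τ) := by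
  have hcl : closure (ball (0 : Euc n) 1) = closedBall 0 1 := closure_ball 0 one_ne_zero
  have hm0 : 0 < m := by
    by_contra hneg
    have := mul_nonpos_of_nonpos_of_nonneg (not_lt.1 hneg) (Real.exp_pos (-8 * (n : ℝ))).le
    linarith
  have hcmp := parabolic_comparison (F := Fj n p j) (isCompact_closedBall (0 : Euc n) 1)
    isOpen_ball ball_subset_closedBall (a := t) (b := t + 2) (u := u)
    (v := fun x s => m * Real.exp (-4 * n * (s - t)) * (1 - ‖x‖ ^ 2)) ?_ ?_ ?_ ?_ ?_ ?_
    x hx (t + τ) ⟨by linarith [hτ.1], by linarith [hτ.2]⟩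
  · simpa using hcmp
  · exact Continuous.continuousOn (by fun_prop)
  · exact h.cont.mono (prod_mono (hcl ▸ Subset.rfl) fun s hs => ht.trans hs.1)
  · intro y hy
    simpa using hut y hy
  · intro y hy s hs
    have hy1 : ‖y‖ = 1 := by
      have h1 : ‖y‖ ≤ 1 := mem_closedBall_zero_iff.1 hy.1
      have h2 : ¬ ‖y‖ < 1 := fun h => hy.2 (mem_ball_zero_iff.2 h)
      linarith
    rw [hy1]
    simpa using h.nonneg y (hcl ▸ hy.1) s (ht.trans hs.1)
  · intro y hy s hs
    set μ := m * Real.exp (-4 * n * (s - t)) with hμ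
    have hy1 : ‖y‖ < 1 := mem_ball_zero_iff.1 hy
    have hμm : m * Real.exp (-8 * n) ≤ μ := by
      refine mul_le_mul_of_nonneg_left (Real.exp_le_exp.2 ?_) hm0.le
      have : (n : ℝ) * (s - t) ≤ n * 2 := by gcongr; linarith [hs.2]
      linarith
    have h1 : ∀ ρ, HasDerivAt (fun ρ : ℝ => μ * (1 - ρ)) (-μ) ρ := fun ρ => by
      simpa using ((hasDerivAt_id ρ).const_sub 1).const_mul μ
    obtain ⟨h3, h4, h5⟩ := radial_jet (n := n) (c := 0) (x := y) (Eventually.of_forall h1)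
      (hasDerivAt_const _ (-μ))
    simp only [sub_zero] at h3 h4 h5
    have h6 : HasDerivAt (fun s => m * Real.exp (-4 * n * (s - t)) * (1 - ‖y‖ ^ 2))
        (-4 * n * μ * (1 - ‖y‖ ^ 2)) s := by
      have h7 : HasDerivAt (fun s : ℝ => -4 * (n : ℝ) * (s - t)) (-4 * n) s := by
        simpa using ((hasDerivAt_id s).sub_const t).const_mul (-4 * (n : ℝ))
      refine ((h7.exp.const_mul m).mul_const (1 - ‖y‖ ^ 2)).congr_deriv ?_
      rw [hμ]
      ring
    refine ⟨h3, _, h6, ?_⟩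
    rw [h4, h5]
    have hn0 : (0 : ℝ) ≤ n := n.cast_nonneg
    have hμ1 : 1 ≤ μ := hm1.trans hμm
    have hμn : 2 * n ≤ μ := hm.trans hμm
    by_cases hy2 : ‖y‖ < 1 / 2
    · have h8 := Fj_nonneg n p j ((2 * -μ) • y)
      have h9 : 0 ≤ n * μ * (2 - 4 * ‖y‖ ^ 2) := by
        refine mul_nonneg (by positivity) ?_
        nlinarith [norm_nonneg y]
      nlinarith [norm_nonneg y]
    · have hgrad : ‖(2 * -μ) • y‖ = 2 * μ * ‖y‖ := by
        rw [norm_smul, Real.norm_eq_abs, abs_mul, abs_neg, abs_of_pos (by linarith : 0 < μ)]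
        norm_num
      have hge : μ ≤ ‖(2 * -μ) • y‖ := by
        rw [hgrad]
        nlinarith
      have hF : μ ^ 2 ≤ Fj n p j ((2 * -μ) • y) := by
        have h10 : μ ^ 2 ≤ ‖(2 * -μ) • y‖ ^ 2 := by gcongr
        refine le_min (h10.trans ?_) (h10.trans ?_)
        · rw [← Real.rpow_two]
          exact Real.rpow_le_rpow_of_exponent_le (hμ1.trans hge) hp.le
        · have : (1 : ℝ) ≤ (j : ℝ) ^ (p - 2) :=
            Real.one_le_rpow (by exact_mod_cast hj) (by linarith)
          exact le_mul_of_one_le_left (by positivity) this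
      have h11 : 0 ≤ n * μ * (1 - ‖y‖ ^ 2) := by
        refine mul_nonneg (by positivity) ?_
        nlinarith [norm_nonneg y]
      nlinarith
  · exact fun y hy s hs => h.isSuperAt isOpen_ball hy (ht.trans_lt hs.1)

/-- A smooth approximation of `max (1/8 - t) 0` at scale `κ`. -/
def softplus (κ t : ℝ) : ℝ := κ * Real.log (1 + Real.exp ((1 / 8 - t) / κ))

theorem softplus_pos {κ : ℝ} (hκ : 0 < κ) (t : ℝ) : 0 < softplus κ t :=
  mul_pos hκ (Real.log_pos (by linarith [Real.exp_pos ((1 / 8 - t) / κ)]))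

theorem softplus_antitone {κ : ℝ} (hκ : 0 < κ) : Antitone (softplus κ) := by
  intro s t hst
  unfold softplus
  gcongr

theorem mul_div_le_softplus {κ : ℝ} (hκ : 0 < κ) (t : ℝ) :
    κ * (Real.exp ((1 / 8 - t) / κ) / (1 + Real.exp ((1 / 8 - t) / κ))) ≤ softplus κ t := by
  have hE := Real.exp_pos ((1 / 8 - t) / κ)
  refine mul_le_mul_of_nonneg_left ?_ hκ.le
  refine le_trans (le_of_eq ?_) (Real.one_sub_inv_le_log_of_pos (by linarith))
  field_simp
  ring

theorem exists_hasDerivAt_softplus {κ : ℝ} (hκ : 0 < κ) (t : ℝ) :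
    ∃ d, HasDerivAt (softplus κ) (-d) t ∧ 0 ≤ d ∧ d ≤ 1 ∧ κ * d ≤ softplus κ t := by
  have hE := Real.exp_pos ((1 / 8 - t) / κ)
  refine ⟨Real.exp ((1 / 8 - t) / κ) / (1 + Real.exp ((1 / 8 - t) / κ)), ?_, by positivity, ?_,
    mul_div_le_softplus hκ t⟩
  · have h1 : HasDerivAt (fun t : ℝ => (1 / 8 - t) / κ) (-1 / κ) t :=
      ((hasDerivAt_id t).const_sub _).div_const κ
    refine (((h1.exp.const_add 1).log (by positivity)).const_mul κ).congr_deriv ?_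
    field_simp
  · rw [div_le_one (by positivity)]
    linarith

theorem one_eighth_le_softplus_zero {κ : ℝ} (hκ : 0 < κ) : 1 / 8 ≤ softplus κ 0 := by
  have h1 : Real.log (Real.exp ((1 / 8 - 0) / κ)) ≤ Real.log (1 + Real.exp ((1 / 8 - 0) / κ)) :=
    Real.log_le_log (Real.exp_pos _) (by linarith)
  rw [Real.log_exp, div_le_iff₀' hκ] at h1
  unfold softplus
  linarith

theorem softplus_le {κ t : ℝ} (hκ : 0 < κ) (hκ' : κ ≤ 1 / 8) (ht : 0 ≤ t) :
    softplus κ t ≤ 1 / 4 := by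
  refine (softplus_antitone hκ ht).trans ?_
  have h0 : 1 ≤ Real.exp ((1 / 8 - 0) / κ) := Real.one_le_exp (by rw [sub_zero]; positivity)
  have h1 : Real.log (1 + Real.exp ((1 / 8 - 0) / κ)) ≤
      Real.log (2 * Real.exp ((1 / 8 - 0) / κ)) := Real.log_le_log (by linarith) (by linarith)
  rw [Real.log_mul two_ne_zero (Real.exp_pos _).ne', Real.log_exp] at h1
  have h2 : κ * (Real.log 2 + (1 / 8 - 0) / κ) = κ * Real.log 2 + 1 / 8 := by
    field_simp
    ring
  have h3 := mul_le_mul_of_nonneg_left h1 hκ.le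
  have h4 := Real.log_two_lt_d9
  unfold softplus
  nlinarith

theorem neg_four_le_mul_log_softplus {κ t : ℝ} (hκ : 0 < κ) (hκ' : κ ≤ 1 / 8) (ht : t ≤ 2) :
    -4 ≤ κ * Real.log (softplus κ t) := by
  have hE := Real.exp_pos ((1 / 8 - 2) / κ)
  have hE1 : Real.exp ((1 / 8 - 2) / κ) ≤ 1 :=
    Real.exp_le_one_iff.2 (div_nonpos_of_nonpos_of_nonneg (by norm_num) hκ.le)
  have h1 : κ * (Real.exp ((1 / 8 - 2) / κ) / 2) ≤ softplus κ t := by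
    refine le_trans ?_ ((mul_div_le_softplus hκ 2).trans (softplus_antitone hκ ht))
    gcongr
    linarith
  have h2 := Real.log_le_log (by positivity) h1
  rw [Real.log_mul hκ.ne' (by positivity), Real.log_div hE.ne' two_ne_zero, Real.log_exp] at h2
  have h3 := Real.one_sub_inv_le_log_of_pos hκ
  have h4 : κ * (1 - κ⁻¹ + ((1 / 8 - 2) / κ - 1)) ≤ κ * Real.log (softplus κ t) := by
    refine mul_le_mul_of_nonneg_left ?_ hκ.le
    linarith [Real.log_two_lt_d9]
  refine le_trans ?_ h4
  have h5 : κ * (1 - κ⁻¹ + ((1 / 8 - 2) / κ - 1)) = -1 + (1 / 8 - 2) := by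
    field_simp
    ring
  rw [h5]
  norm_num

theorem softplus_two_le {κ : ℝ} (hκ : 0 < κ) :
    softplus κ 2 ≤ κ * Real.exp ((1 / 8 - 2) / κ) := by
  have hE := Real.exp_pos ((1 / 8 - 2) / κ)
  refine mul_le_mul_of_nonneg_left ?_ hκ.le
  linarith [Real.log_le_sub_one_of_pos (show 0 < 1 + Real.exp ((1 / 8 - 2) / κ) by linarith)]

theorem softplus_two_le_self {κ : ℝ} (hκ : 0 < κ) : softplus κ 2 ≤ κ :=
  (softplus_two_le hκ).trans (mul_le_of_le_one_right hκ.le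
    (Real.exp_le_one_iff.2 (div_nonpos_of_nonpos_of_nonneg (by norm_num) hκ.le)))

theorem mul_log_softplus_two_le {κ : ℝ} (hκ : 0 < κ) (hκ' : κ ≤ 1 / 8) :
    κ * Real.log (softplus κ 2) ≤ -(15 / 8) := by
  have h1 := Real.log_le_log (softplus_pos hκ 2) (softplus_two_le hκ)
  rw [Real.log_mul hκ.ne' (Real.exp_pos _).ne', Real.log_exp] at h1
  have h2 : Real.log κ ≤ 0 := Real.log_nonpos hκ.le (by linarith)
  calc κ * Real.log (softplus κ 2) ≤ κ * (0 + (1 / 8 - 2) / κ) := by gcongr; linarith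
    _ = -(15 / 8) := by field_simp; norm_num

/-- The steady barrier profile. -/
def profile (α C κ σ : ℝ) : ℝ := C / α * σ ^ α + κ * Real.log σ

/-- The moving barrier, in terms of `s = 1 - |x|²` and time. -/
def barrier (α C κ s t : ℝ) : ℝ :=
  profile α C κ (s + softplus κ t ^ (1 / α)) -
    (C / α * softplus κ t + κ / α * Real.log (softplus κ t))

theorem barrier_zero {α C κ : ℝ} (hα : 0 < α) (hκ : 0 < κ) (t : ℝ) : barrier α C κ 0 t = 0 := by
  have hy := softplus_pos hκ t
  rw [barrier, profile, zero_add, ← Real.rpow_mul hy.le, one_div_mul_cancel hα.ne', Real.rpow_one,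
    Real.log_rpow hy]
  ring

theorem hasDerivAt_profile {α C κ σ : ℝ} (hα : 0 < α) (hσ : 0 < σ) :
    HasDerivAt (profile α C κ) (C * σ ^ (α - 1) + κ / σ) σ := by
  refine (((Real.hasDerivAt_rpow_const (Or.inl hσ.ne')).const_mul (C / α)).add
    ((Real.hasDerivAt_log hσ.ne').const_mul κ)).congr_deriv ?_
  field_simp

theorem hasDerivAt_profile_deriv {α C κ σ : ℝ} (hσ : 0 < σ) :
    HasDerivAt (fun σ => C * σ ^ (α - 1) + κ / σ)
      (-(((1 - α) * (C * σ ^ (α - 1)) + κ / σ) / σ)) σ := by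
  have h1 := ((Real.hasDerivAt_rpow_const (p := α - 1) (Or.inl hσ.ne')).const_mul C).add
    ((hasDerivAt_inv hσ.ne').const_mul κ)
  refine h1.congr_deriv ?_
  rw [Real.rpow_sub_one hσ.ne' (α - 1)]
  field_simp
  ring

theorem le_Fj_of_profile_deriv_le {n : ℕ} {p α C κ σ : ℝ} {j : ℕ} (hp : 2 < p)
    (hαp : (α - 1) * (p - 1) = -1) (hC : 0 < C) (hκ : 0 < κ) (hσ : 0 < σ)
    (hj : C ^ (p - 1) ≤ (j : ℝ) ^ (p - 2) * κ) {ξ : Euc n}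
    (hξ : C * σ ^ (α - 1) + κ / σ ≤ ‖ξ‖) :
    C ^ (p - 1) / σ * (C * σ ^ (α - 1) + κ / σ) ≤ Fj n p j ξ := by
  set w := C * σ ^ (α - 1) + κ / σ with hw
  have hw1 : C * σ ^ (α - 1) ≤ w := by rw [hw]; linarith [div_pos hκ hσ]
  have hw2 : κ / σ ≤ w := by
    rw [hw]
    linarith [mul_pos hC (Real.rpow_pos_of_pos hσ (α - 1))]
  have hw0 : 0 < w := (div_pos hκ hσ).trans_le hw2
  refine le_min ?_ ?_
  · have h1 : C ^ (p - 1) / σ ≤ w ^ (p - 1) := by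
      refine le_trans (le_of_eq ?_) (Real.rpow_le_rpow (by positivity) hw1 (by linarith))
      rw [Real.mul_rpow hC.le (by positivity), ← Real.rpow_mul hσ.le, hαp, Real.rpow_neg_one]
      rfl
    calc C ^ (p - 1) / σ * w ≤ w ^ (p - 1) * w := by gcongr
      _ = w ^ p := by
        rw [← Real.rpow_add_one hw0.ne']
        ring_nf
      _ ≤ ‖ξ‖ ^ p := Real.rpow_le_rpow hw0.le hξ (by linarith)
  · calc C ^ (p - 1) / σ * w ≤ (j : ℝ) ^ (p - 2) * κ / σ * w := by gcongr
      _ = (j : ℝ) ^ (p - 2) * (κ / σ * w) := by ring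
      _ ≤ (j : ℝ) ^ (p - 2) * (w * w) := by gcongr
      _ ≤ (j : ℝ) ^ (p - 2) * ‖ξ‖ ^ 2 := by rw [← sq]; gcongr

theorem softplus_rpow_le {α κ t : ℝ} (hα : 0 < α) (hα1 : α < 1) (hκ : 0 < κ) (hκ' : κ ≤ 1 / 8)
    (ht : 0 ≤ t) : softplus κ t ^ (1 / α) ≤ 1 / 4 := by
  have h1 := softplus_le hκ hκ' ht
  refine le_trans ?_ h1
  conv_rhs => rw [← Real.rpow_one (softplus κ t)]
  exact Real.rpow_le_rpow_of_exponent_ge (softplus_pos hκ t) (by linarith)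
    ((one_le_div hα).2 hα1.le)

theorem exists_hasDerivAt_barrier_time {α C κ s : ℝ} (hα : 0 < α) (hC : 0 < C) (hκ : 0 < κ)
    (hs : 0 ≤ s) (t : ℝ) :
    ∃ d, HasDerivAt (barrier α C κ s) d t ∧ d ≤ (C + 1) / α := by
  obtain ⟨d, h1, h2, h3, h4⟩ := exists_hasDerivAt_softplus hκ t
  have hy := softplus_pos hκ t
  have h5 : HasDerivAt (fun t => s + softplus κ t ^ (1 / α))
      (-d * (1 / α) * softplus κ t ^ (1 / α - 1)) t :=
    (h1.rpow_const (Or.inl hy.ne')).const_add s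
  have hσ : 0 < s + softplus κ t ^ (1 / α) := by positivity
  have h6 := ((hasDerivAt_profile (C := C) (κ := κ) hα hσ).comp t
    (h := fun t => s + softplus κ t ^ (1 / α)) h5).sub
    ((h1.const_mul (C / α)).add ((h1.log hy.ne').const_mul (κ / α)))
  refine ⟨_, h6, ?_⟩
  have h7 : 0 ≤ (C * (s + softplus κ t ^ (1 / α)) ^ (α - 1) + κ / (s + softplus κ t ^ (1 / α))) *
      (d * (1 / α) * softplus κ t ^ (1 / α - 1)) := by positivity
  have h8 : C / α * d ≤ C / α := mul_le_of_le_one_right (by positivity) h3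
  have h9 : κ / α * (d / softplus κ t) ≤ 1 / α := by
    rw [div_mul_div_comm, div_le_div_iff₀ (by positivity) hα]
    nlinarith
  have h10 : -d / softplus κ t = -(d / softplus κ t) := neg_div _ _
  rw [add_div, h10]
  linarith

theorem isSubAt_barrier {n : ℕ} {p α C κ : ℝ} {j : ℕ} (hp : 2 < p) (hα : 0 < α) (hα1 : α < 1)
    (hαp : (α - 1) * (p - 1) = -1) (hC : 4 + 2 * n + 2 / α ≤ C) (hκ : 0 < κ) (hκ' : κ ≤ 1 / 8)
    (hj : C ^ (p - 1) ≤ (j : ℝ) ^ (p - 2) * κ) {x : Euc n} (hx : 1 / 2 < ‖x‖) (hx1 : ‖x‖ < 1)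
    {t : ℝ} (ht : 0 ≤ t) :
    IsSubAt (Fj n p j) (fun x t => barrier α C κ (1 - ‖x‖ ^ 2) t) x t := by
  have hn0 : (0 : ℝ) ≤ n := n.cast_nonneg
  have hα2 : 2 ≤ 2 / α := by rw [le_div_iff₀ hα]; linarith
  have hC1 : 1 ≤ C := by linarith
  set θ := softplus κ t ^ (1 / α) with hθ
  have hθ0 : 0 < θ := Real.rpow_pos_of_pos (softplus_pos hκ t) _
  have hθ1 : θ ≤ 1 / 4 := softplus_rpow_le hα hα1 hκ hκ' ht
  set P := C / α * softplus κ t + κ / α * Real.log (softplus κ t) with hP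
  have hρ : ‖x‖ ^ 2 < 1 := by nlinarith
  have hρ' : 1 / 4 < ‖x‖ ^ 2 := by nlinarith
  have hlin : ∀ ρ : ℝ, HasDerivAt (fun ρ : ℝ => 1 - ρ + θ) (-1) ρ := fun ρ =>
    ((hasDerivAt_id ρ).const_sub 1).add_const θ
  have h1 : ∀ᶠ ρ in 𝓝 (‖x - 0‖ ^ 2), HasDerivAt (fun ρ => profile α C κ (1 - ρ + θ) - P)
      (-(C * (1 - ρ + θ) ^ (α - 1) + κ / (1 - ρ + θ))) ρ := by
    rw [sub_zero]
    filter_upwards [gt_mem_nhds hρ] with ρ hρ1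
    have := ((hasDerivAt_profile (C := C) (κ := κ) hα (show 0 < 1 - ρ + θ by linarith)).comp ρ
      (h := fun ρ : ℝ => 1 - ρ + θ) (hlin ρ)).sub_const P
    exact this.congr_deriv (by ring)
  set σ := 1 - ‖x‖ ^ 2 + θ with hσdef
  have hσ : 0 < σ := by linarith
  have hσ1 : σ ≤ 1 := by linarith
  set w := C * σ ^ (α - 1) + κ / σ with hw
  have h2 : HasDerivAt (fun ρ => -(C * (1 - ρ + θ) ^ (α - 1) + κ / (1 - ρ + θ)))
      (-(((1 - α) * (C * σ ^ (α - 1)) + κ / σ) / σ)) (‖x - 0‖ ^ 2) := by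
    rw [sub_zero]
    have := ((hasDerivAt_profile_deriv (α := α) (C := C) (κ := κ) hσ).comp (‖x‖ ^ 2)
      (h := fun ρ : ℝ => 1 - ρ + θ) (hlin _)).neg
    exact this.congr_deriv (by ring)
  obtain ⟨h3, h4, h5⟩ := radial_jet h1 h2
  simp only [sub_zero] at h3 h4 h5
  obtain ⟨d, h6, h7⟩ := exists_hasDerivAt_barrier_time (C := C) (s := 1 - ‖x‖ ^ 2) hα
    (by linarith) hκ (by linarith) t
  refine ⟨h3, d, h6, h7.trans ?_⟩
  change (C + 1) / α ≤ lap n (fun y => profile α C κ (1 - ‖y‖ ^ 2 + θ) - P) x +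
    Fj n p j (gradient (fun y => profile α C κ (1 - ‖y‖ ^ 2 + θ) - P) x)
  rw [h4, h5, ← hσdef, ← hw]
  have hCσ : 0 < C * σ ^ (α - 1) := mul_pos (by linarith) (Real.rpow_pos_of_pos hσ _)
  have hκσ : 0 < κ / σ := div_pos hκ hσ
  have hw0 : 0 < w := by rw [hw]; positivity
  have hwC : C ≤ w := by
    have : 1 ≤ σ ^ (α - 1) := Real.one_le_rpow_of_pos_of_le_one_of_nonpos hσ hσ1 (by linarith)
    rw [hw]
    nlinarith
  have hF : C ^ (p - 1) / σ * w ≤ Fj n p j ((2 * -w) • x) := by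
    refine le_Fj_of_profile_deriv_le hp hαp (by linarith) hκ hσ hj ?_
    rw [norm_smul, Real.norm_eq_abs, abs_mul, abs_neg, abs_of_pos hw0, abs_of_pos two_pos]
    nlinarith
  have hB : C ≤ C ^ (p - 1) := by
    conv_lhs => rw [← Real.rpow_one C]
    exact Real.rpow_le_rpow_of_exponent_le hC1 (by linarith)
  have hlap1 : ((1 - α) * (C * σ ^ (α - 1)) + κ / σ) / σ ≤ w / σ := by
    gcongr
    rw [hw]
    nlinarith
  have hlap0 : 0 ≤ ((1 - α) * (C * σ ^ (α - 1)) + κ / σ) / σ :=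
    div_nonneg (add_nonneg (mul_nonneg (by linarith) hCσ.le) hκσ.le) hσ.le
  have hwσ : w ≤ w / σ := by rw [le_div_iff₀ hσ]; nlinarith
  have hlap2 : 4 * ‖x‖ ^ 2 * (((1 - α) * (C * σ ^ (α - 1)) + κ / σ) / σ) ≤ 4 * (w / σ) :=
    mul_le_mul (by linarith) hlap1 hlap0 (by norm_num)
  have hlap3 : 2 * n * w ≤ 2 * n * (w / σ) := by gcongr
  have hwσ0 : 0 ≤ w / σ := hw0.le.trans hwσ
  have hF2 : C * (w / σ) ≤ C ^ (p - 1) / σ * w := by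
    rw [div_mul_eq_mul_div, mul_div_assoc]
    exact mul_le_mul_of_nonneg_right hB hwσ0
  have hR : (C + 1) / α ≤ 2 / α * (w / σ) := by
    rw [div_mul_eq_mul_div]
    gcongr
    linarith
  have hfin : (4 + 2 * n + 2 / α) * (w / σ) ≤ C * (w / σ) := by gcongr
  linarith

theorem continuousOn_barrier {n : ℕ} {α κ : ℝ} (C : ℝ) (hκ : 0 < κ) (a b : ℝ) :
    ContinuousOn (fun q : Euc n × ℝ => barrier α C κ (1 - ‖q.1‖ ^ 2) (q.2 - a))
      (closedBall 0 1 ×ˢ Icc a b) := by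
  have hy : Continuous fun q : Euc n × ℝ => softplus κ (q.2 - a) := by
    unfold softplus
    refine continuous_const.mul (Continuous.log (by fun_prop) fun q => ?_)
    positivity
  have hy0 : ∀ q : Euc n × ℝ, softplus κ (q.2 - a) ≠ 0 := fun q => (softplus_pos hκ _).ne'
  have hσ : ContinuousOn (fun q : Euc n × ℝ => 1 - ‖q.1‖ ^ 2 + softplus κ (q.2 - a) ^ (1 / α))
      (closedBall 0 1 ×ˢ Icc a b) :=
    ContinuousOn.add (by fun_prop) (hy.continuousOn.rpow_const fun q _ => Or.inl (hy0 q))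
  have hσ0 : ∀ q ∈ closedBall (0 : Euc n) 1 ×ˢ Icc a b,
      1 - ‖q.1‖ ^ 2 + softplus κ (q.2 - a) ^ (1 / α) ≠ 0 := fun q hq => by
    have h1 : ‖q.1‖ ≤ 1 := mem_closedBall_zero_iff.1 hq.1
    have h2 := Real.rpow_pos_of_pos (softplus_pos hκ (q.2 - a)) (1 / α)
    nlinarith [norm_nonneg q.1]
  unfold barrier profile
  refine ContinuousOn.sub (ContinuousOn.add (continuousOn_const.mul ?_)
    (continuousOn_const.mul (hσ.log hσ0))) (ContinuousOn.add ?_ ?_)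
  · exact hσ.rpow_const fun q hq => Or.inl (hσ0 q hq)
  · exact continuousOn_const.mul hy.continuousOn
  · exact continuousOn_const.mul (hy.continuousOn.log fun q _ => hy0 q)

theorem barrier_initial_le {α C κ s : ℝ} (hα : 0 < α) (hα1 : α < 1) (hC : 0 ≤ C) (hκ : 0 < κ)
    (hκ' : κ ≤ 1 / 8) (hs : 0 ≤ s) :
    barrier α C κ s 0 ≤ (C + 1) / (1 / 8 : ℝ) ^ (1 / α) * s := by
  have hz := barrier_zero (C := C) hα hκ 0
  unfold barrier profile at hz ⊢
  rw [zero_add] at hz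
  set θ := softplus κ 0 ^ (1 / α)
  have hθ0 : 0 < θ := Real.rpow_pos_of_pos (softplus_pos hκ 0) _
  have hθ1 : θ ≤ 1 / 4 := softplus_rpow_le hα hα1 hκ hκ' le_rfl
  have hθ2 : (1 / 8 : ℝ) ^ (1 / α) ≤ θ :=
    Real.rpow_le_rpow (by norm_num) (one_eighth_le_softplus_zero hκ) (by positivity)
  have hsθ : 0 ≤ s / θ := by positivity
  have heq : s + θ = θ * (1 + s / θ) := by field_simp; ring
  have h1 : (s + θ) ^ α - θ ^ α ≤ α * (s / θ) := by
    rw [heq, Real.mul_rpow hθ0.le (by positivity)]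
    have h2 := rpow_one_add_le_one_add_mul_self (s := s / θ) (p := α) (by linarith) hα.le hα1.le
    have h3 : θ ^ α ≤ 1 := Real.rpow_le_one hθ0.le (by linarith) hα.le
    have h4 : 0 < θ ^ α := Real.rpow_pos_of_pos hθ0 _
    nlinarith [mul_nonneg hα.le hsθ]
  have h2 : Real.log (s + θ) - Real.log θ ≤ s / θ := by
    rw [heq, Real.log_mul hθ0.ne' (by positivity)]
    linarith [Real.log_le_sub_one_of_pos (show 0 < 1 + s / θ by positivity)]
  have h3 : C / α * ((s + θ) ^ α - θ ^ α) ≤ C * (s / θ) := by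
    calc C / α * ((s + θ) ^ α - θ ^ α) ≤ C / α * (α * (s / θ)) := by gcongr
      _ = C * (s / θ) := by field_simp
  have h4 : κ * (Real.log (s + θ) - Real.log θ) ≤ 1 * (s / θ) := by
    calc κ * (Real.log (s + θ) - Real.log θ) ≤ κ * (s / θ) := by gcongr
      _ ≤ 1 * (s / θ) := by gcongr; linarith
  have h5 : (C + 1) * (s / θ) ≤ (C + 1) / (1 / 8 : ℝ) ^ (1 / α) * s := by
    rw [div_mul_eq_mul_div, mul_div_assoc]
    gcongr
  linarith

theorem barrier_inner_le {α C κ t : ℝ} (hα : 0 < α) (hα1 : α < 1) (hC : 0 ≤ C) (hκ : 0 < κ)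
    (hκ' : κ ≤ 1 / 8) (ht : t ∈ Icc (0 : ℝ) 2) : barrier α C κ (3 / 4) t ≤ (C + 4) / α := by
  unfold barrier profile
  have hθ0 : 0 < softplus κ t ^ (1 / α) := Real.rpow_pos_of_pos (softplus_pos hκ t) _
  have hθ1 : softplus κ t ^ (1 / α) ≤ 1 / 4 := softplus_rpow_le hα hα1 hκ hκ' ht.1
  have h1 : C / α * (3 / 4 + softplus κ t ^ (1 / α)) ^ α ≤ C / α :=
    mul_le_of_le_one_right (by positivity) (Real.rpow_le_one (by linarith) (by linarith) hα.le)
  have h2 : κ * Real.log (3 / 4 + softplus κ t ^ (1 / α)) ≤ 0 :=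
    mul_nonpos_of_nonneg_of_nonpos hκ.le (Real.log_nonpos (by linarith) (by linarith))
  have h3 : 0 ≤ C / α * softplus κ t := mul_nonneg (by positivity) (softplus_pos hκ t).le
  have h4 : -(4 / α) ≤ κ / α * Real.log (softplus κ t) := by
    rw [div_mul_eq_mul_div, ← neg_div]
    gcongr
    exact neg_four_le_mul_log_softplus hκ hκ' ht.2
  rw [add_div]
  linarith

theorem barrier_final_ge {α C κ s : ℝ} (hα : 0 < α) (hα1 : α < 1) (hC : 0 ≤ C) (hκ : 0 < κ)
    (hκ' : κ ≤ 1 / 8) (hCκ : C * κ ≤ 7 / 8) (hs : 0 < s) :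
    κ * Real.log s + 1 ≤ barrier α C κ s 2 := by
  unfold barrier profile
  have hθ0 : 0 < softplus κ 2 ^ (1 / α) := Real.rpow_pos_of_pos (softplus_pos hκ 2) _
  have h1 : 0 ≤ C / α * (s + softplus κ 2 ^ (1 / α)) ^ α := by positivity
  have h2 : κ * Real.log s ≤ κ * Real.log (s + softplus κ 2 ^ (1 / α)) := by
    gcongr
    linarith
  have h3 : C / α * softplus κ 2 + κ / α * Real.log (softplus κ 2) ≤ -1 := by
    have h4 := mul_log_softplus_two_le hκ hκ'
    have h5 := mul_le_mul_of_nonneg_left (softplus_two_le_self hκ) hC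
    rw [div_mul_eq_mul_div, div_mul_eq_mul_div, ← add_div, div_le_iff₀ hα]
    linarith
  linarith

/-- A regularized solution which is large enough at time `t` lies above the moving barrier in an
annulus during the next two units of time. -/
theorem IsRegSol.barrier_le {n : ℕ} {p α C κ : ℝ} {j : ℕ} (hp : 2 < p) (hα : 0 < α) (hα1 : α < 1)
    (hαp : (α - 1) * (p - 1) = -1) (hC : 4 + 2 * n + 2 / α ≤ C) (hκ : 0 < κ) (hκ' : κ ≤ 1 / 8)
    (hj1 : 1 ≤ j) (hj : C ^ (p - 1) ≤ (j : ℝ) ^ (p - 2) * κ) {u0 : Euc n → ℝ}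
    {u : Euc n → ℝ → ℝ} (h : IsRegSol n p (ball 0 1) j u0 u) {m t : ℝ} (ht : 0 ≤ t)
    (hm : 2 * n + 1 + 4 / 3 * ((C + 4) / α) ≤ m * Real.exp (-8 * n))
    (hm' : (C + 1) / (1 / 8 : ℝ) ^ (1 / α) ≤ m)
    (hut : ∀ x ∈ closedBall (0 : Euc n) 1, m * (1 - ‖x‖ ^ 2) ≤ u x t) {x : Euc n}
    (hx : 1 / 2 < ‖x‖) (hx1 : ‖x‖ < 1) :
    barrier α C κ (1 - ‖x‖ ^ 2) 2 ≤ u x (t + 2) := by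
  have hcl : closure (ball (0 : Euc n) 1) = closedBall 0 1 := closure_ball 0 one_ne_zero
  have hn0 : (0 : ℝ) ≤ n := n.cast_nonneg
  have hC0 : 0 ≤ C := le_trans (by positivity) hC
  have hQ : 0 ≤ (C + 4) / α := by positivity
  have hm0 : 0 ≤ m := le_trans (by positivity) hm'
  have hcmp := parabolic_comparison (F := Fj n p j)
    ((isCompact_closedBall (0 : Euc n) 1).diff (isOpen_ball (x := (0 : Euc n)) (ε := 1 / 2)))
    ((isOpen_ball (x := (0 : Euc n)) (ε := 1)).sdiff
      (isClosed_closedBall (x := (0 : Euc n)) (ε := 1 / 2)))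
    (sdiff_subset_sdiff ball_subset_closedBall ball_subset_closedBall) (a := t) (b := t + 2) (u := u)
    (v := fun x s => barrier α C κ (1 - ‖x‖ ^ 2) (s - t)) ?_ ?_ ?_ ?_ ?_ ?_
    x ⟨by simpa using hx1.le, by simpa using hx.le⟩ (t + 2) ⟨by linarith, le_rfl⟩
  · simpa using hcmp
  · exact (continuousOn_barrier C hκ t (t + 2)).mono (prod_mono sdiff_subset Subset.rfl)
  · exact h.cont.mono (prod_mono (hcl ▸ sdiff_subset) fun s hs => ht.trans hs.1)
  · intro y hy
    have hy1 : ‖y‖ ≤ 1 := mem_closedBall_zero_iff.1 hy.1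
    have hs : 0 ≤ 1 - ‖y‖ ^ 2 := by nlinarith [norm_nonneg y]
    rw [sub_self]
    exact (barrier_initial_le hα hα1 hC0 hκ hκ' hs).trans
      ((mul_le_mul_of_nonneg_right hm' hs).trans (hut y hy.1))
  · intro y hy s hs
    have hy1 : ‖y‖ ≤ 1 := mem_closedBall_zero_iff.1 hy.1.1
    have hy2 : 1 / 2 ≤ ‖y‖ := not_lt.1 fun h => hy.1.2 (mem_ball_zero_iff.2 h)
    by_cases hy3 : ‖y‖ < 1
    · have hy4 : ‖y‖ = 1 / 2 := le_antisymm (not_lt.1 fun h4 => hy.2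
        ⟨mem_ball_zero_iff.2 hy3, fun h5 => absurd (mem_closedBall_zero_iff.1 h5)
          (not_le.2 h4)⟩) hy2
      have hst : s - t ∈ Icc (0 : ℝ) 2 := ⟨by linarith [hs.1], by linarith [hs.2]⟩
      have h1 := h.maintain hp hj1 ht (by linarith) (by linarith) hut hy.1.1 hst
      have h2 : m * Real.exp (-8 * n) ≤ m * Real.exp (-4 * n * (s - t)) := by
        refine mul_le_mul_of_nonneg_left (Real.exp_le_exp.2 ?_) hm0
        have : (n : ℝ) * (s - t) ≤ n * 2 := mul_le_mul_of_nonneg_left hst.2 hn0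
        linarith
      have h3 := barrier_inner_le hα hα1 hC0 hκ hκ' hst
      rw [hy4, show (1 : ℝ) - (1 / 2) ^ 2 = 3 / 4 by norm_num] at h1 ⊢
      rw [add_sub_cancel] at h1
      linarith
    · have hy4 : ‖y‖ = 1 := le_antisymm hy1 (not_lt.1 hy3)
      rw [hy4, one_pow, sub_self, barrier_zero hα hκ]
      exact h.nonneg y (hcl ▸ hy.1.1) s (ht.trans hs.1)
  · intro y hy s hs
    have hy1 : ‖y‖ < 1 := mem_ball_zero_iff.1 hy.1
    have hy2 : 1 / 2 < ‖y‖ := not_le.1 fun h => hy.2 (mem_closedBall_zero_iff.2 h)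
    refine IsSubAt.comp_add_const (v := fun x s => barrier α C κ (1 - ‖x‖ ^ 2) s) (s := -t) ?_
    exact isSubAt_barrier hp hα hα1 hαp hC hκ hκ' hj hy2 hy1 (by linarith [hs.1])
  · exact fun y hy s hs => h.isSuperAt isOpen_ball hy.1 (ht.trans_lt hs.1)

theorem exists_half_le_of_large {n : ℕ} {p α C : ℝ} (hp : 2 < p) (hα : 0 < α) (hα1 : α < 1)
    (hαp : (α - 1) * (p - 1) = -1) (hC : 4 + 2 * n + 2 / α ≤ C) {u0 : Euc n → ℝ}
    {u : ℕ → Euc n → ℝ → ℝ} (h : ∀ j, 1 ≤ j → IsRegSol n p (ball 0 1) j u0 (u j)) {m t : ℝ}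
    (ht : 0 ≤ t) (hm : 2 * n + 1 + 4 / 3 * ((C + 4) / α) ≤ m * Real.exp (-8 * n))
    (hm' : (C + 1) / (1 / 8 : ℝ) ^ (1 / α) ≤ m)
    (hut : ∀ j, 1 ≤ j → ∀ x ∈ closedBall (0 : Euc n) 1, m * (1 - ‖x‖ ^ 2) ≤ u j x t) {x : Euc n}
    (hx : 1 / 2 < ‖x‖) (hx1 : ‖x‖ < 1) : ∃ j, 1 ≤ j ∧ 1 / 2 ≤ u j x (t + 2) := by
  have hC0 : 0 < C := lt_of_lt_of_le (by positivity) hC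
  set s := 1 - ‖x‖ ^ 2 with hs
  have hs0 : 0 < s := by nlinarith [norm_nonneg x]
  have hlim : Tendsto (fun j : ℕ => C ^ (p - 1) / (j : ℝ) ^ (p - 2)) atTop (𝓝 0) :=
    ((tendsto_rpow_atTop (by linarith : 0 < p - 2)).comp
      tendsto_natCast_atTop_atTop).const_div_atTop _
  have hlim' : ∀ b c : ℝ, 0 < c →
      ∀ᶠ j : ℕ in atTop, b * (C ^ (p - 1) / (j : ℝ) ^ (p - 2)) ≤ c := fun b c hc => by
    have := hlim.const_mul b
    rw [mul_zero] at this
    exact this.eventually (ge_mem_nhds hc)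
  obtain ⟨j, ⟨⟨h1, h2⟩, h3⟩, h4⟩ := ((((hlim' 1 (1 / 8) (by norm_num)).and
    (hlim' C (7 / 8) (by norm_num))).and (hlim' (-Real.log s) (1 / 2) (by norm_num))).and
    (eventually_ge_atTop 1)).exists
  refine ⟨j, h4, ?_⟩
  have hj0 : (0 : ℝ) < j := by exact_mod_cast h4
  have hJ : 0 < (j : ℝ) ^ (p - 2) := Real.rpow_pos_of_pos hj0 _
  set κ := C ^ (p - 1) / (j : ℝ) ^ (p - 2) with hκdef
  have hκ : 0 < κ := div_pos (Real.rpow_pos_of_pos hC0 _) hJ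
  rw [one_mul] at h1
  have h5 := (h j h4).barrier_le hp hα hα1 hαp hC hκ h1 h4
    (by rw [hκdef, mul_div_cancel₀ _ hJ.ne']) ht hm hm' (hut j h4) hx hx1
  have h6 := barrier_final_ge hα hα1 hC0.le hκ h1 h2 hs0
  linarith

/-- **Theorem 4 of Porretta–Souplet** (for the unit ball). For every `ε > 0` there is
`M > 0` such that for any `u₀ ∈ X` with `∫_Ω u₀(x)(1-|x|) dx ≥ M`, the loss of boundary
conditions set of the global viscosity solution meets the `ε`-ball around every boundary
point. -/
theorem large_data_loss_of_bc_near_every_point (n : ℕ) (hn : 1 ≤ n) (p : ℝ) (hp : 2 < p)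
    (ε : ℝ) (hε : 0 < ε) :
    ∃ M > (0:ℝ), ∀ u0 : Euc n → ℝ, MemX (ball (0 : Euc n) 1) u0 →
      M ≤ ∫ x in ball (0 : Euc n) 1, u0 x * (1 - ‖x‖) →
      ∀ u : ℕ → Euc n → ℝ → ℝ,
        (∀ j, 1 ≤ j → IsRegSol n p (ball (0 : Euc n) 1) j u0 (u j)) →
        ∀ x₀ ∈ frontier (ball (0 : Euc n) 1),
          ∃ y₀ ∈ frontier (ball (0 : Euc n) 1), ‖y₀ - x₀‖ < ε ∧
            ∃ t > (0:ℝ),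
              0 < liminf (fun x => Usup u x t) (nhdsWithin y₀ (ball (0 : Euc n) 1)) := by
  have hcl : closure (ball (0 : Euc n) 1) = closedBall 0 1 := closure_ball 0 one_ne_zero
  obtain ⟨c, hc, t, ht, hmass⟩ := exists_weighted_mass_le hn
  set α := (p - 2) / (p - 1) with hαdef
  have hp1 : 0 < p - 1 := by linarith
  have hα : 0 < α := div_pos (by linarith) hp1
  have hα1 : α < 1 := (div_lt_one hp1).2 (by linarith)
  have hαp : (α - 1) * (p - 1) = -1 := by rw [hαdef]; field_simp; ring
  set C := 4 + 2 * n + 2 / α with hCdef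
  have hC : 0 < C := by positivity
  set m := Real.exp (8 * n) * (2 * n + 1 + 4 / 3 * ((C + 4) / α)) +
    (C + 1) / (1 / 8 : ℝ) ^ (1 / α) with hmdef
  have hm0 : 0 < m := by positivity
  have hm1 : 2 * n + 1 + 4 / 3 * ((C + 4) / α) ≤ m * Real.exp (-8 * n) := by
    have h1 : Real.exp (8 * n) * Real.exp (-8 * n) = 1 := by
      rw [← Real.exp_add]
      simp
    have h2 : 0 ≤ (C + 1) / (1 / 8 : ℝ) ^ (1 / α) * Real.exp (-8 * n) := by positivity
    rw [hmdef, add_mul, mul_right_comm, h1, one_mul]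
    linarith
  have hm2 : (C + 1) / (1 / 8 : ℝ) ^ (1 / α) ≤ m := by
    rw [hmdef]
    exact le_add_of_nonneg_left (by positivity)
  refine ⟨m / c, by positivity, fun u0 hu0 hM u hu x₀ hx₀ => ⟨x₀, hx₀, by simpa using hε,
    t + 2, by linarith, ?_⟩⟩
  obtain ⟨S, hS⟩ := (isCompact_closedBall (0 : Euc n) 1).bddAbove_image
    (hcl ▸ hu0.1.continuousOn)
  have hS' : ∀ x ∈ closedBall (0 : Euc n) 1, u0 x ≤ S := fun x hx => hS (mem_image_of_mem _ hx)
  have hS0 : 0 ≤ S := (hu0.2.1 0 (hcl ▸ by simp)).trans (hS' 0 (by simp))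
  have hsup : ∀ j, 1 ≤ j → IsHeatSuper n S (u j) := fun j hj =>
    (hu j hj).isHeatSuper (by linarith) hS0 hS'
  have hlow : ∀ j, 1 ≤ j → ∀ x ∈ closedBall (0 : Euc n) 1, m * (1 - ‖x‖ ^ 2) ≤ u j x t := by
    intro j hj x hx
    refine le_trans (mul_le_mul_of_nonneg_right ?_ ?_) (hmass S (u j) (hsup j hj) x hx)
    · have h1 : ∫ y in ball (0 : Euc n) 1, u j y 0 * (1 - ‖y‖) =
          ∫ y in ball (0 : Euc n) 1, u0 y * (1 - ‖y‖) :=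
        setIntegral_congr_fun measurableSet_ball fun y hy => by
          simp only [(hu j hj).ic y (subset_closure hy)]
      rw [h1]
      exact (div_le_iff₀' hc).1 hM
    · have := mem_closedBall_zero_iff.1 hx
      nlinarith [norm_nonneg x]
  have hle : ∀ x ∈ ball (0 : Euc n) 1, ∀ j : {j : ℕ // 1 ≤ j}, u j.1 x (t + 2) ≤ S :=
    fun x hx j => (hsup j.1 j.2).le x (ball_subset_closedBall hx) _ (by linarith)
  have hx₀1 : ‖x₀‖ = 1 := by
    rw [frontier_ball (0 : Euc n) one_ne_zero] at hx₀
    simpa using hx₀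
  have : (𝓝[ball (0 : Euc n) 1] x₀).NeBot :=
    mem_closure_iff_nhdsWithin_neBot.1 (frontier_subset_closure hx₀)
  have : Nonempty {j : ℕ // 1 ≤ j} := ⟨⟨1, le_rfl⟩⟩
  refine lt_of_lt_of_le (show (0 : ℝ) < 1 / 2 by norm_num) (le_liminf_of_le ?_ ?_)
  · refine IsBoundedUnder.isCoboundedUnder_ge (isBoundedUnder_of_eventually_le (a := S) ?_)
    filter_upwards [self_mem_nhdsWithin] with x hx using ciSup_le (hle x hx)
  · have hev : ∀ᶠ x in 𝓝[ball (0 : Euc n) 1] x₀, 1 / 2 < ‖x‖ :=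
      (continuous_norm.tendsto x₀).mono_left nhdsWithin_le_nhds |>.eventually
        (lt_mem_nhds (by rw [hx₀1]; norm_num))
    filter_upwards [self_mem_nhdsWithin, hev] with x hx hx2
    obtain ⟨j, hj, hj2⟩ := exists_half_le_of_large hp hα hα1 hαp le_rfl hu ht.le hm1 hm2 hlow hx2
      (mem_ball_zero_iff.1 hx)
    exact hj2.trans (le_ciSup (f := fun j : {j : ℕ // 1 ≤ j} => u j.1 x (t + 2))
      ⟨S, forall_mem_range.2 (hle x hx)⟩ ⟨j, hj⟩)

end
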